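/- arXiv:2605.25914 — 3 statements merged into one kernel-verified Lean document; each statement's English description precedes it below -/
import Mathlib

section
/- For every integer r ≥ 3, there exists a real δ_r > 0 such that the entire interval [1 − δ_r, 1] is contained in Π^{(r)}_∞, the set of Turán densities of (possibly infinite) families of r-graphs. -/
open Filter

/-- A finite `r`-graph: a collection of `r`-element subsets (edges) of a finite
vertex set, which we take to be `Fin n`. -/
structure HGraph (r : ℕ) where
  n : ℕ
  edges : Finset (Finset (Fin n))
  card_eq : ∀ e ∈ edges, e.card = r

/-- `H` embeds into `G` as a subgraph (via an injective map on vertices sending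
edges to edges). -/
def HGraph.Embeds {r : ℕ} (H G : HGraph r) : Prop :=
  ∃ f : Fin H.n → Fin G.n, Function.Injective f ∧ ∀ e ∈ H.edges, e.image f ∈ G.edges

/-- `G` is `F`-free: no member of the family `F` embeds into `G`. -/
def IsFree {r : ℕ} (F : Set (HGraph r)) (G : HGraph r) : Prop :=
  ∀ H ∈ F, ¬ H.Embeds G

/-- `ex(n, F)`: the maximum number of edges of an `F`-free `r`-graph on `n` vertices. -/
noncomputable def exNum (r : ℕ) (F : Set (HGraph r)) (n : ℕ) : ℕ :=
  sSup { m : ℕ | ∃ G : HGraph r, G.n = n ∧ IsFree F G ∧ G.edges.card = m }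

/-- The Turán density of the family `F` is `x`. -/
def HasTuranDensity (r : ℕ) (F : Set (HGraph r)) (x : ℝ) : Prop :=
  Tendsto (fun n => (exNum r F n : ℝ) / (n.choose r : ℝ)) atTop (nhds x)

/-- `Π^{(r)}_∞`: the set of Turán densities of (possibly infinite) families of `r`-graphs. -/
def PiInf (r : ℕ) : Set ℝ := { x | ∃ F : Set (HGraph r), HasTuranDensity r F x }

open scoped Classical in
/-- The Lagrange polynomial of a pattern `E` (a set of multisets on `V`), evaluated at `w`. -/
noncomputable def patPoly {V : Type} [Fintype V] (r : ℕ) (E : Set (Multiset V)) (w : V → ℝ) : ℝ :=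
  ∑ t : Fin r → V, if Finset.univ.val.map t ∈ E then ∏ i, w (t i) else 0

/-- `β` is the Lagrangian of some `r`-uniform pattern. -/
def IsLag (r : ℕ) (β : ℝ) : Prop :=
  ∃ (V : Type) (_ : Fintype V) (E : Set (Multiset V)),
    IsGreatest (patPoly r E '' stdSimplex ℝ V) β

/-- `y` is a limit from below of Lagrangians of `r`-uniform patterns. -/
def LagLimit (r : ℕ) (y : ℝ) : Prop := ∀ ε > 0, ∃ s, IsLag r s ∧ y - ε < s ∧ s ≤ y

section PatPoly

variable {U V : Type} [Fintype U] [Fintype V] {r : ℕ}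

lemma patPoly_congr {E E' : Set (Multiset V)} (h : ∀ m : Multiset V, m.card = r → (m ∈ E ↔ m ∈ E'))
    (w : V → ℝ) : patPoly r E w = patPoly r E' w := by
  unfold patPoly
  refine Finset.sum_congr rfl fun t _ => ?_
  rw [h _ (by simp)]

lemma patPoly_nonneg (E : Set (Multiset V)) {w : V → ℝ} (hw : ∀ v, 0 ≤ w v) :
    0 ≤ patPoly r E w := by
  unfold patPoly
  refine Finset.sum_nonneg fun t _ => ?_
  split_ifs
  · exact Finset.prod_nonneg fun i _ => hw _
  · exact le_rfl

lemma patPoly_mono {E E' : Set (Multiset V)} (h : E ⊆ E') {w : V → ℝ} (hw : ∀ v, 0 ≤ w v) :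
    patPoly r E w ≤ patPoly r E' w := by
  unfold patPoly
  refine Finset.sum_le_sum fun t _ => ?_
  have h0 : 0 ≤ ∏ i, w (t i) := Finset.prod_nonneg fun i _ => hw _
  by_cases h1 : Finset.univ.val.map t ∈ E
  · rw [if_pos h1, if_pos (h h1)]
  · rw [if_neg h1]
    split_ifs <;> simp [h0]

lemma patPoly_univ (w : V → ℝ) : patPoly r Set.univ w = (∑ v, w v) ^ r := by
  classical
  unfold patPoly
  simp [Finset.sum_pow', Fintype.piFinset_univ]

lemma patPoly_smul (E : Set (Multiset V)) (c : ℝ) (w : V → ℝ) :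
    patPoly r E (fun v => c * w v) = c ^ r * patPoly r E w := by
  unfold patPoly
  rw [Finset.mul_sum]
  refine Finset.sum_congr rfl fun t _ => ?_
  split_ifs <;> simp [Finset.prod_mul_distrib]

lemma continuous_patPoly (E : Set (Multiset V)) : Continuous (patPoly r E) := by
  unfold patPoly
  refine continuous_finsetSum _ fun t _ => ?_
  split_ifs <;> fun_prop

lemma patPoly_comap [DecidableEq V] (π : U → V) (E : Set (Multiset V)) (w : U → ℝ) :
    patPoly r {m | m.map π ∈ E} w = patPoly r E (fun v => ∑ u with π u = v, w u) := by
  classical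
  unfold patPoly
  rw [← Finset.sum_fiberwise (g := fun t : Fin r → U => π ∘ t)]
  refine Finset.sum_congr rfl fun s _ => ?_
  rw [Finset.prod_univ_sum]
  have : ({t | π ∘ t = s} : Finset (Fin r → U)) =
      Fintype.piFinset fun i => ({u | π u = s i} : Finset U) := by
    ext t; simp [funext_iff]
  rw [this]
  split_ifs with hs
  · refine Finset.sum_congr rfl fun t ht => ?_
    have : π ∘ t = s := by
      ext i; simpa using (Fintype.mem_piFinset.1 ht i)
    rw [if_pos]
    simpa [Multiset.map_map, this] using hs
  · refine Finset.sum_eq_zero fun t ht => ?_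
    have : π ∘ t = s := by
      ext i; simpa using (Fintype.mem_piFinset.1 ht i)
    rw [if_neg]
    simpa [Multiset.map_map, this] using hs

lemma patPoly_le_mul_pow {E : Set (Multiset V)} {β : ℝ} (hr : r ≠ 0)
    (h : ∀ w ∈ stdSimplex ℝ V, patPoly r E w ≤ β) {w : V → ℝ} (hw : ∀ v, 0 ≤ w v) :
    patPoly r E w ≤ β * (∑ v, w v) ^ r := by
  have hs : 0 ≤ ∑ v, w v := Finset.sum_nonneg fun v _ => hw v
  rcases hs.eq_or_lt with h0 | h0
  · have : ∀ v, w v = 0 := fun v =>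
      (Finset.sum_eq_zero_iff_of_nonneg fun v _ => hw v).1 h0.symm v (Finset.mem_univ v)
    have hw0 : w = fun v => 0 * w v := by ext v; simp [this v]
    rw [hw0, patPoly_smul]
    simp [hr]
  · set σ := ∑ v, w v
    have h1 : (fun v => σ⁻¹ * w v) ∈ stdSimplex ℝ V :=
      ⟨fun v => mul_nonneg (inv_nonneg.2 hs) (hw v), by
        rw [← Finset.mul_sum]; exact inv_mul_cancel₀ h0.ne'⟩
    have h2 := h _ h1
    rw [patPoly_smul, inv_pow, inv_mul_le_iff₀ (pow_pos h0 r)] at h2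
    linarith

lemma IsLag.exists_max (V : Type) [Fintype V] [Nonempty V] (r : ℕ) (E : Set (Multiset V)) :
    ∃ β, IsGreatest (patPoly r E '' stdSimplex ℝ V) β := by
  classical
  have hne : (stdSimplex ℝ V).Nonempty := ⟨_, single_mem_stdSimplex ℝ (Classical.arbitrary V)⟩
  obtain ⟨w, hw, hmax⟩ := (isCompact_stdSimplex ℝ V).exists_isMaxOn hne
    (continuous_patPoly (r := r) E).continuousOn
  exact ⟨_, ⟨w, hw, rfl⟩, by rintro _ ⟨v, hv, rfl⟩; exact hmax hv⟩

lemma IsLag.nonneg {β : ℝ} (h : IsLag r β) : 0 ≤ β := by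
  obtain ⟨V, _, E, ⟨w, hw, rfl⟩, -⟩ := h
  exact patPoly_nonneg E hw.1

lemma IsLag.le_one {β : ℝ} (h : IsLag r β) : β ≤ 1 := by
  obtain ⟨V, _, E, ⟨w, hw, rfl⟩, -⟩ := h
  calc _ ≤ _ := patPoly_mono (Set.subset_univ E) hw.1
    _ = 1 := by rw [patPoly_univ, hw.2, one_pow]

end PatPoly

section Averaging

variable {V X : Type} [Fintype V] [Fintype X] [DecidableEq X] {r : ℕ}

lemma sum_prod_comp_embedding (w : V → ℝ) (hw : ∑ v, w v = 1) (ι : Fin r ↪ X)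
    (g : (Fin r → V) → ℝ) :
    ∑ φ : X → V, (∏ j, w (φ j)) * g (φ ∘ ι) = ∑ t : Fin r → V, (∏ i, w (t i)) * g t := by
  classical
  rw [← Finset.sum_fiberwise (g := fun φ : X → V => φ ∘ ι)]
  refine Finset.sum_congr rfl fun t _ => ?_
  have h1 : ∑ φ : X → V with φ ∘ ι = t, (∏ j, w (φ j)) * g (φ ∘ ι) =
      (∑ φ : X → V with φ ∘ ι = t, ∏ j, w (φ j)) * g t := by
    rw [Finset.sum_mul]
    refine Finset.sum_congr rfl fun φ hφ => ?_
    rw [(Finset.mem_filter.1 hφ).2]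
  rw [h1]
  congr 1
  have h2 : ({φ | φ ∘ ι = t} : Finset (X → V)) =
      Fintype.piFinset fun j => ({v | ∀ i, ι i = j → v = t i} : Finset V) := by
    ext φ
    simp only [Finset.mem_filter, Finset.mem_univ, true_and, Fintype.mem_piFinset, funext_iff,
      Function.comp]
    exact ⟨fun h j i hij => by rw [← hij, h], fun h i => h _ i rfl⟩
  rw [h2, ← Finset.prod_univ_sum, ← Finset.prod_subset (Finset.subset_univ (Finset.univ.map ι)),
    Finset.prod_map]
  · refine Finset.prod_congr rfl fun i _ => ?_
    have : ({v | ∀ i', ι i' = ι i → v = t i'} : Finset V) = {t i} := by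
      ext v
      simp only [Finset.mem_filter, Finset.mem_univ, true_and, Finset.mem_singleton]
      exact ⟨fun h => h i rfl, fun h i' hi => by rw [h, ι.injective hi]⟩
    rw [this, Finset.sum_singleton]
  · intro j _ hj
    have : ({v | ∀ i, ι i = j → v = t i} : Finset V) = Finset.univ := by
      ext v
      simp only [Finset.mem_filter, Finset.mem_univ, true_and, iff_true]
      intro i hi
      exact absurd (by simp [← hi]) hj
    rw [this, hw]

lemma sum_prod_eq_one (w : V → ℝ) (hw : ∑ v, w v = 1) : ∑ φ : X → V, ∏ j, w (φ j) = 1 := by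
  classical
  rw [← Fintype.piFinset_univ, ← Finset.prod_univ_sum]
  simp [hw]

lemma exists_map_card_ge (n : ℕ) (E : Set (Multiset V)) {w : V → ℝ} (hw : w ∈ stdSimplex ℝ V) :
    ∃ (φ : Fin n → V) (S : Finset (Finset (Fin n))),
      (∀ e ∈ S, e.card = r) ∧ (∀ e ∈ S, e.val.map φ ∈ E) ∧
      (n.choose r : ℝ) * patPoly r E w ≤ S.card := by
  classical
  let N : (Fin n → V) → Finset (Finset (Fin n)) := fun φ =>
    (Finset.powersetCard r Finset.univ).filter fun e => e.val.map φ ∈ E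
  have hsum : ∑ φ : Fin n → V, (∏ j, w (φ j)) * ((N φ).card : ℝ) =
      (n.choose r : ℝ) * patPoly r E w := by
    have h1 : ∀ φ : Fin n → V, ((N φ).card : ℝ) =
        ∑ e ∈ Finset.powersetCard r (Finset.univ : Finset (Fin n)),
          if e.val.map φ ∈ E then (1 : ℝ) else 0 := fun φ => by simp [N]
    simp_rw [h1, Finset.mul_sum]
    rw [Finset.sum_comm]
    have h2 : ∀ e ∈ Finset.powersetCard r (Finset.univ : Finset (Fin n)),
        ∑ φ : Fin n → V, (∏ j, w (φ j)) * (if e.val.map φ ∈ E then (1 : ℝ) else 0) =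
          patPoly r E w := by
      intro e he
      have hc : e.card = r := (Finset.mem_powersetCard.1 he).2
      have key := sum_prod_comp_embedding w hw.2 (e.orderEmbOfFin hc).toEmbedding
        (fun t => if Finset.univ.val.map t ∈ E then (1 : ℝ) else 0)
      have hmap : ∀ φ : Fin n → V,
          Finset.univ.val.map (φ ∘ (e.orderEmbOfFin hc).toEmbedding) = e.val.map φ := by
        intro φ
        rw [← Multiset.map_map, ← Finset.map_val]
        congr 2
        ext j
        simp
      simp only [hmap] at key
      rw [key]
      unfold patPoly
      refine Finset.sum_congr rfl fun t _ => ?_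
      split_ifs <;> simp
    rw [Finset.sum_congr rfl h2]
    simp
  by_contra! hcon
  have hlt : ∀ φ : Fin n → V, ((N φ).card : ℝ) < (n.choose r : ℝ) * patPoly r E w := by
    intro φ
    exact hcon φ (N φ) (fun e he => (Finset.mem_powersetCard.1 (Finset.mem_filter.1 he).1).2)
      (fun e he => (Finset.mem_filter.1 he).2)
  have hone := sum_prod_eq_one (X := Fin n) w hw.2
  have hW : ∀ φ : Fin n → V, 0 ≤ ∏ j, w (φ j) := fun φ => Finset.prod_nonneg fun j _ => hw.1 _
  have : ∑ φ : Fin n → V, (∏ j, w (φ j)) * ((N φ).card : ℝ) <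
      ∑ φ : Fin n → V, (∏ j, w (φ j)) * ((n.choose r : ℝ) * patPoly r E w) := by
    refine Finset.sum_lt_sum (fun φ _ => mul_le_mul_of_nonneg_left (hlt φ).le (hW φ)) ?_
    have : ∃ φ : Fin n → V, 0 < ∏ j, w (φ j) := by
      by_contra! hc
      have : ∑ φ : Fin n → V, ∏ j, w (φ j) ≤ 0 := Finset.sum_nonpos fun φ _ => hc φ
      linarith
    obtain ⟨φ, hφ⟩ := this
    exact ⟨φ, Finset.mem_univ _, mul_lt_mul_of_pos_left (hlt φ) hφ⟩
  rw [hsum, ← Finset.sum_mul, hone, one_mul] at this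
  exact lt_irrefl _ this

lemma card_mul_factorial_le (hr : r ≠ 0) (n : ℕ) {E : Set (Multiset V)} {β : ℝ}
    (hβ : ∀ w ∈ stdSimplex ℝ V, patPoly r E w ≤ β) (φ : Fin n → V) (S : Finset (Finset (Fin n)))
    (hS : ∀ e ∈ S, e.card = r) (hE : ∀ e ∈ S, e.val.map φ ∈ E) :
    (S.card : ℝ) * r.factorial ≤ (n : ℝ) ^ r * β := by
  classical
  have h1 : patPoly r {m | m.map φ ∈ E} (fun _ : Fin n => (1 : ℝ)) ≤ (n : ℝ) ^ r * β := by
    rw [patPoly_comap]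
    refine (patPoly_le_mul_pow hr hβ fun v => Finset.sum_nonneg fun _ _ => zero_le_one).trans ?_
    have h0 : ∑ v, ∑ i with φ i = v, (1 : ℝ) = n := by
      rw [Finset.sum_fiberwise Finset.univ φ fun _ => (1 : ℝ)]
      simp
    rw [h0, mul_comm]
  refine le_trans ?_ h1
  have h2 : patPoly r {m | m.map φ ∈ E} (fun _ : Fin n => (1 : ℝ)) =
      (({t : Fin r → Fin n | (Finset.univ.val.map t).map φ ∈ E} : Finset _).card : ℝ) := by
    unfold patPoly
    simp
  rw [h2]
  have h3 : (S.attach ×ˢ (Finset.univ : Finset (Equiv.Perm (Fin r)))).card ≤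
      ({t : Fin r → Fin n | (Finset.univ.val.map t).map φ ∈ E} : Finset _).card := by
    have hrange : ∀ (e : {e // e ∈ S}) (σ : Equiv.Perm (Fin r)),
        Finset.univ.map (σ.toEmbedding.trans (e.1.orderEmbOfFin (hS e.1 e.2)).toEmbedding) =
          e.1 := by
      intro e σ
      ext j
      rw [← Finset.map_map, Finset.map_univ_equiv]
      simp
    refine Finset.card_le_card_of_injOn
      (fun p => (p.1.1.orderEmbOfFin (hS p.1.1 p.1.2)) ∘ p.2) ?_ ?_
    · rintro ⟨e, σ⟩ -
      simp only [Finset.coe_filter, Finset.mem_univ, true_and, Set.mem_ofPred_eq]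
      have h4 := congrArg Finset.val (hrange e σ)
      rw [Finset.map_val] at h4
      have h5 : Finset.univ.val.map ((e.1.orderEmbOfFin (hS e.1 e.2)) ∘ σ) = e.1.val := h4
      rw [h5]
      exact hE _ e.2
    · rintro ⟨e, σ⟩ - ⟨e', σ'⟩ - h
      have hee : e = e' := by
        apply Subtype.ext
        rw [← hrange e σ, ← hrange e' σ']
        congr 1
        ext i
        exact congrArg Fin.val (congrFun h i)
      subst hee
      have : σ = σ' := by
        ext i
        have := congrFun h i
        simpa using congrArg Fin.val ((e.1.orderEmbOfFin (hS e.1 e.2)).injective this)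
      rw [this]
  rw [Finset.card_product] at h3
  simp only [Finset.card_attach, Finset.card_univ, Fintype.card_perm, Fintype.card_fin] at h3
  exact_mod_cast h3

end Averaging

/-- Limits from below of Lagrangians are Turán densities. -/
theorem LagLimit.mem_PiInf {r : ℕ} (hr : r ≠ 0) {y : ℝ} (hy : LagLimit r y) : y ∈ PiInf r := by
  classical
  let Hom : HGraph r → ℝ → Prop := fun G s =>
    ∃ (V : Type) (_ : Fintype V) (E : Set (Multiset V)) (φ : Fin G.n → V),
      (∀ w ∈ stdSimplex ℝ V, patPoly r E w ≤ s) ∧ (∀ e ∈ G.edges, e.val.map φ ∈ E)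
  have hcomp : ∀ (G H : HGraph r) s, H.Embeds G → Hom G s → Hom H s := by
    rintro G H s ⟨f, hf, hfe⟩ ⟨V, _, E, φ, h1, h2⟩
    refine ⟨V, _, E, φ ∘ f, h1, fun e he => ?_⟩
    have := h2 _ (hfe e he)
    rwa [Finset.image_val_of_injOn hf.injOn, Multiset.map_map] at this
  let F : Set (HGraph r) := {H | ∀ s ≤ y, ¬ Hom H s}
  have hup : ∀ G : HGraph r, IsFree F G → (G.edges.card : ℝ) * r.factorial ≤ (G.n : ℝ) ^ r * y := by
    intro G hG
    have hGF : G ∉ F := fun hGF => hG G hGF ⟨id, Function.injective_id, by simp⟩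
    simp only [F, Set.mem_ofPred_eq, not_forall, not_not] at hGF
    obtain ⟨s, hs, V, _, E, φ, h1, h2⟩ := hGF
    refine (card_mul_factorial_le hr G.n h1 φ G.edges G.card_eq h2).trans ?_
    gcongr
  have hbdd : ∀ n, BddAbove
      { m : ℕ | ∃ G : HGraph r, G.n = n ∧ IsFree F G ∧ G.edges.card = m } := by
    intro n
    refine ⟨Fintype.card (Finset (Fin n)), ?_⟩
    rintro m ⟨G, rfl, -, rfl⟩
    exact Finset.card_le_univ _
  have hlow : ∀ s, IsLag r s → s ≤ y → ∀ n : ℕ, (n.choose r : ℝ) * s ≤ exNum r F n := by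
    rintro s ⟨V, _, E, ⟨w, hw, rfl⟩, hmax⟩ hsy n
    obtain ⟨φ, S, h1, h2, h3⟩ := exists_map_card_ge (r := r) n E hw
    refine h3.trans ?_
    have hmem : S.card ∈
        { m : ℕ | ∃ G : HGraph r, G.n = n ∧ IsFree F G ∧ G.edges.card = m } := by
      refine ⟨⟨n, S, h1⟩, rfl, ?_, rfl⟩
      intro H hH hHG
      exact hH _ hsy (hcomp _ H _ hHG ⟨V, _, E, φ, fun w hw => hmax ⟨w, hw, rfl⟩, h2⟩)
    exact_mod_cast le_csSup (hbdd n) hmem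
  have hex : ∀ n : ℕ, (exNum r F n : ℝ) * r.factorial ≤ (n : ℝ) ^ r * y := by
    intro n
    have hne : { m : ℕ | ∃ G : HGraph r, G.n = n ∧ IsFree F G ∧ G.edges.card = m }.Nonempty := by
      obtain ⟨s, ⟨V, _, E, ⟨w, hw, rfl⟩, hmax⟩, -, hsy⟩ := hy 1 one_pos
      obtain ⟨φ, S, h1, h2, h3⟩ := exists_map_card_ge (r := r) n E hw
      refine ⟨S.card, ⟨n, S, h1⟩, rfl, ?_, rfl⟩
      intro H hH hHG
      exact hH _ hsy (hcomp _ H _ hHG ⟨V, _, E, φ, fun w hw => hmax ⟨w, hw, rfl⟩, h2⟩)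
    obtain ⟨G, hn, hG, hc⟩ := Nat.sSup_mem hne (hbdd n)
    have := hup G hG
    rw [hc, hn] at this
    exact this
  refine ⟨F, ?_⟩
  have hlim : Tendsto (fun n : ℕ => ((n : ℝ) ^ r / r.factorial / (n.choose r : ℝ)) * y) atTop
      (nhds y) := by
    have hz : ∀ᶠ n : ℕ in atTop, (n.choose r : ℝ) ≠ 0 := by
      filter_upwards [eventually_ge_atTop r] with n hn
      exact_mod_cast (Nat.choose_pos hn).ne'
    have h := (Asymptotics.isEquivalent_iff_tendsto_one hz).1 (isEquivalent_choose r).symm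
    simpa using h.mul_const y
  refine tendsto_order.2 ⟨fun a ha => ?_, fun a ha => ?_⟩
  · obtain ⟨s, hs, hs1, hs2⟩ := hy (y - a) (by linarith)
    filter_upwards [eventually_ge_atTop r] with n hn
    have hpos : (0 : ℝ) < n.choose r := by exact_mod_cast Nat.choose_pos hn
    rw [lt_div_iff₀ hpos]
    have := hlow s hs hs2 n
    nlinarith
  · filter_upwards [eventually_ge_atTop r, (tendsto_order.1 hlim).2 a ha] with n hn hlt
    have hpos : (0 : ℝ) < n.choose r := by exact_mod_cast Nat.choose_pos hn
    refine lt_of_le_of_lt ?_ hlt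
    have hf : (0 : ℝ) < r.factorial := by exact_mod_cast r.factorial_pos
    rw [div_div, div_mul_eq_mul_div, div_le_div_iff₀ hpos (by positivity)]
    nlinarith [hex n]

section PatPolyOps

variable {U V : Type} [Fintype U] [Fintype V] {r : ℕ}

lemma patPoly_union {E E' : Set (Multiset V)} (h : Disjoint E E') (w : V → ℝ) :
    patPoly r (E ∪ E') w = patPoly r E w + patPoly r E' w := by
  unfold patPoly
  rw [← Finset.sum_add_distrib]
  refine Finset.sum_congr rfl fun t _ => ?_
  by_cases h1 : Finset.univ.val.map t ∈ E
  · have h2 : Finset.univ.val.map t ∉ E' := fun h2 => Set.disjoint_left.1 h h1 h2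
    rw [if_pos (Set.mem_union_left _ h1), if_pos h1, if_neg h2, add_zero]
  · by_cases h2 : Finset.univ.val.map t ∈ E'
    · rw [if_pos (Set.mem_union_right _ h2), if_neg h1, if_pos h2, zero_add]
    · rw [if_neg (fun h3 => h3.elim h1 h2), if_neg h1, if_neg h2, zero_add]

lemma patPoly_empty (w : V → ℝ) : patPoly r (∅ : Set (Multiset V)) w = 0 := by
  simp [patPoly]

lemma patPoly_iUnion {I : Type} [Fintype I] {E : I → Set (Multiset V)}
    (h : Pairwise fun i j => Disjoint (E i) (E j)) (w : V → ℝ) :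
    patPoly r (⋃ i, E i) w = ∑ i, patPoly r (E i) w := by
  classical
  have key : ∀ s : Finset I, patPoly r (⋃ i ∈ s, E i) w = ∑ i ∈ s, patPoly r (E i) w := by
    intro s
    induction s using Finset.induction_on with
    | empty => simp [patPoly_empty]
    | insert a s ha ih =>
      rw [Finset.set_biUnion_insert, patPoly_union, ih, Finset.sum_insert ha]
      rw [Set.disjoint_iUnion₂_right]
      intro i hi
      exact h fun hai => ha (hai ▸ hi)
  simpa using key Finset.univ

lemma patPoly_compl (E : Set (Multiset V)) (w : V → ℝ) :
    patPoly r Eᶜ w = (∑ v, w v) ^ r - patPoly r E w := by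
  rw [← patPoly_univ, ← Set.union_compl_self E, patPoly_union disjoint_compl_right]
  ring

lemma patPoly_image_map {ι : U → V} (hι : Function.Injective ι) (E : Set (Multiset U))
    (w : V → ℝ) : patPoly r (Multiset.map ι '' E) w = patPoly r E (w ∘ ι) := by
  unfold patPoly
  symm
  refine Fintype.sum_of_injective (fun t : Fin r → U => ι ∘ t) hι.comp_left _ _ ?_ ?_
  · intro t ht
    rw [if_neg]
    rintro ⟨m, -, hm⟩
    apply ht
    have : ∀ i, ∃ u, ι u = t i := by
      intro i
      have : t i ∈ Finset.univ.val.map t := Multiset.mem_map_of_mem _ (Finset.mem_univ i)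
      rw [← hm] at this
      obtain ⟨u, -, hu⟩ := Multiset.mem_map.1 this
      exact ⟨u, hu⟩
    choose s hs using this
    exact ⟨s, funext hs⟩
  · intro t
    rw [← Multiset.map_map, (Multiset.map_injective hι).mem_set_image]
    rfl

lemma patPoly_image_cons_map {ι : U → V} (hι : Function.Injective ι) {v : V}
    (hv : v ∉ Set.range ι) (E : Set (Multiset U)) (w : V → ℝ) :
    patPoly (r + 1) ((fun m => v ::ₘ m.map ι) '' E) w = (r + 1) * w v * patPoly r E (w ∘ ι) := by
  classical
  have hmap : ∀ (i : Fin (r + 1)) (t : Fin r → U),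
      Finset.univ.val.map (i.insertNth (α := fun _ => V) v (ι ∘ t)) =
        v ::ₘ (Finset.univ.val.map t).map ι := by
    intro i t
    rw [Fin.univ_succAbove r i]
    simp [Function.comp_def]
  have hinj : Function.Injective fun p : Fin (r + 1) × (Fin r → U) =>
      p.1.insertNth (α := fun _ => V) v (ι ∘ p.2) := by
    rintro ⟨i, t⟩ ⟨j, s⟩ h
    simp only at h
    have hij : i = j := by
      by_contra hij
      obtain ⟨k, hk⟩ := Fin.exists_succAbove_eq hij
      have h1 := congrFun h i
      rw [Fin.insertNth_apply_same, ← hk, Fin.insertNth_apply_succAbove] at h1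
      exact hv ⟨_, h1.symm⟩
    subst hij
    have : t = s := by
      ext k
      have h1 := congrFun h (i.succAbove k)
      rw [Fin.insertNth_apply_succAbove, Fin.insertNth_apply_succAbove] at h1
      exact hι h1
    rw [this]
  have hsum : patPoly (r + 1) ((fun m => v ::ₘ m.map ι) '' E) w =
      ∑ p : Fin (r + 1) × (Fin r → U), w v *
        if Finset.univ.val.map p.2 ∈ E then ∏ i, (w ∘ ι) (p.2 i) else 0 := by
    unfold patPoly
    symm
    refine Fintype.sum_of_injective _ hinj _ _ ?_ ?_
    · intro t ht
      rw [if_neg]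
      rintro ⟨m, -, hm⟩
      apply ht
      have hvt : v ∈ Finset.univ.val.map t := by rw [← hm]; exact Multiset.mem_cons_self _ _
      obtain ⟨i, -, hi⟩ := Multiset.mem_map.1 hvt
      have hrest : m.map ι = Finset.univ.val.map fun k => t (i.succAbove k) := by
        rw [Fin.univ_succAbove r i] at hm
        simp only [Finset.cons_val, Multiset.map_cons, hi, Finset.map_val, Multiset.map_map]
          at hm
        exact (Multiset.cons_inj_right v).1 hm
      have : ∀ k, ∃ u, ι u = t (i.succAbove k) := by
        intro k
        have : t (i.succAbove k) ∈ Finset.univ.val.map fun k => t (i.succAbove k) :=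
          Multiset.mem_map_of_mem (fun k => t (i.succAbove k)) (Finset.mem_univ k)
        rw [← hrest] at this
        obtain ⟨u, -, hu⟩ := Multiset.mem_map.1 this
        exact ⟨u, hu⟩
      choose s hs using this
      refine ⟨(i, s), ?_⟩
      rw [Fin.insertNth_eq_iff]
      exact ⟨hi.symm, funext hs⟩
    · rintro ⟨i, t⟩
      simp only [hmap]
      have hinj' : Function.Injective fun m : Multiset U => v ::ₘ m.map ι :=
        fun m m' h => Multiset.map_injective hι ((Multiset.cons_inj_right v).1 h)
      rw [hinj'.mem_set_image (s := E), mul_ite, mul_zero]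
      congr 1
      rw [Fin.prod_univ_succAbove _ i]
      simp
  rw [hsum, Fintype.sum_prod_type]
  simp only [← Finset.mul_sum]
  unfold patPoly
  simp only [Finset.sum_const, Finset.card_univ, Fintype.card_fin, nsmul_eq_mul]
  push_cast
  ring

end PatPolyOps

section Operations

variable {r : ℕ} {β γ : ℝ}

lemma IsLag.binary (hr : r ≠ 0) (hβ : IsLag r β) (hγ : IsLag r γ) {P : Set (Multiset Bool)}
    (hP : ∀ m ∈ P, true ∈ m ∧ false ∈ m) {M : ℝ}
    (hM : IsGreatest ((fun x : ℝ => patPoly r P (fun b => cond b x (1 - x)) + β * x ^ r +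
      γ * (1 - x) ^ r) '' Set.Icc 0 1) M) : IsLag r M := by
  classical
  obtain ⟨V₁, _, E₁, ⟨w₁, hw₁, hβ₁⟩, hmax₁⟩ := hβ
  obtain ⟨V₂, _, E₂, ⟨w₂, hw₂, hγ₂⟩, hmax₂⟩ := hγ
  have hle₁ : ∀ w ∈ stdSimplex ℝ V₁, patPoly r E₁ w ≤ β := fun w hw => hmax₁ ⟨w, hw, rfl⟩
  have hle₂ : ∀ w ∈ stdSimplex ℝ V₂, patPoly r E₂ w ≤ γ := fun w hw => hmax₂ ⟨w, hw, rfl⟩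
  let A : Set (Multiset (V₁ ⊕ V₂)) := Multiset.map Sum.inl '' (E₁ ∩ {m | m ≠ 0})
  let B : Set (Multiset (V₁ ⊕ V₂)) := Multiset.map Sum.inr '' E₂
  let C : Set (Multiset (V₁ ⊕ V₂)) := {m | m.map Sum.isLeft ∈ P}
  have hAB : Disjoint A B := by
    rw [Set.disjoint_left]
    rintro _ ⟨m, ⟨-, hm⟩, rfl⟩ ⟨m', -, h⟩
    obtain ⟨v, hv⟩ := Multiset.exists_mem_of_ne_zero hm
    have : Sum.inl v ∈ m'.map (Sum.inr : V₂ → V₁ ⊕ V₂) := h ▸ Multiset.mem_map_of_mem _ hv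
    simp at this
  have hABC : Disjoint (A ∪ B) C := by
    rw [Set.disjoint_left]
    rintro m (⟨m, -, rfl⟩ | ⟨m, -, rfl⟩) hC
    · simpa using (hP _ hC).2
    · simpa using (hP _ hC).1
  have hpoly : ∀ w : V₁ ⊕ V₂ → ℝ, patPoly r (A ∪ B ∪ C) w =
      patPoly r E₁ (w ∘ Sum.inl) + patPoly r E₂ (w ∘ Sum.inr) +
        patPoly r P (fun b => cond b (∑ v, w (Sum.inl v)) (∑ v, w (Sum.inr v))) := by
    intro w
    rw [patPoly_union hABC, patPoly_union hAB, patPoly_image_map Sum.inl_injective,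
      patPoly_image_map Sum.inr_injective, patPoly_comap]
    congr 1
    · congr 1
      refine patPoly_congr (fun m hm => ?_) _
      simp only [Set.mem_inter_iff, Set.mem_ofPred_eq, and_iff_left_iff_imp]
      rintro - rfl
      exact hr hm.symm
    · congr 1
      ext b
      rw [Finset.sum_filter, Fintype.sum_sum_type]
      cases b <;> simp
  refine ⟨V₁ ⊕ V₂, inferInstance, A ∪ B ∪ C, ?_, ?_⟩
  · obtain ⟨x, hx, hxM⟩ := hM.1
    refine ⟨Sum.elim (fun v => x * w₁ v) (fun v => (1 - x) * w₂ v), ⟨?_, ?_⟩, ?_⟩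
    · rintro (v | v)
      · exact mul_nonneg hx.1 (hw₁.1 v)
      · exact mul_nonneg (by linarith [hx.2]) (hw₂.1 v)
    · rw [Fintype.sum_sum_type]
      simp [← Finset.mul_sum, hw₁.2, hw₂.2]
    · rw [hpoly, ← hxM]
      simp only [Sum.elim_comp_inl, Sum.elim_comp_inr, patPoly_smul, Sum.elim_inl, Sum.elim_inr,
        ← Finset.mul_sum, hw₁.2, hw₂.2, hβ₁, hγ₂, mul_one]
      ring
  · rintro _ ⟨w, hw, rfl⟩
    rw [hpoly]
    set x := ∑ v, w (Sum.inl v) with hx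
    have hy : ∑ v, w (Sum.inr v) = 1 - x := by
      have := hw.2
      rw [Fintype.sum_sum_type] at this
      linarith
    rw [hy]
    have hx0 : 0 ≤ x := Finset.sum_nonneg fun v _ => hw.1 _
    have hy0 : 0 ≤ 1 - x := hy ▸ Finset.sum_nonneg fun v _ => hw.1 _
    have h1 := patPoly_le_mul_pow hr hle₁ (w := w ∘ Sum.inl) fun v => hw.1 _
    have h2 := patPoly_le_mul_pow hr hle₂ (w := w ∘ Sum.inr) fun v => hw.1 _
    simp only [Function.comp_apply, ← hx, hy] at h1 h2
    have h3 := hM.2 ⟨x, ⟨hx0, by linarith⟩, rfl⟩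
    simp only at h3
    linarith

lemma patPoly_both_sides (hr : r ≠ 0) (w : Bool → ℝ) :
    patPoly r {m | true ∈ m ∧ false ∈ m} w =
      (w true + w false) ^ r - w true ^ r - w false ^ r := by
  have hi : ∀ b : Bool, Function.Injective fun _ : Unit => b := fun b _ _ _ => rfl
  have h0 : ∀ b : Bool,
      patPoly r (Multiset.map (fun _ : Unit => b) '' {m | m ≠ 0}) w = w b ^ r := by
    intro b
    rw [patPoly_image_map (hi b), patPoly_congr (E' := Set.univ), patPoly_univ]
    · simp
    · intro m hm
      simp only [ne_eq, Set.mem_ofPred_eq, Set.mem_univ, iff_true]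
      rintro rfl
      exact hr hm.symm
  have hdisj : Disjoint (Multiset.map (fun _ : Unit => true) '' {m | m ≠ 0})
      (Multiset.map (fun _ : Unit => false) '' {m | m ≠ 0}) := by
    rw [Set.disjoint_left]
    rintro _ ⟨m, hm, rfl⟩ ⟨m', hm', h⟩
    obtain ⟨v, hv⟩ := Multiset.exists_mem_of_ne_zero hm
    have : true ∈ m'.map (fun _ : Unit => false) := h ▸ Multiset.mem_map_of_mem _ hv
    simp [Multiset.mem_replicate] at this
  have hc := patPoly_compl (r := r) ((Multiset.map (fun _ : Unit => true) '' {m | m ≠ 0}) ∪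
      (Multiset.map (fun _ : Unit => false) '' {m | m ≠ 0})) w
  rw [patPoly_union hdisj, h0, h0] at hc
  rw [sub_sub, ← Fintype.sum_bool, ← hc]
  refine patPoly_congr (fun m hm => ?_) w
  have hm0 : m ≠ 0 := by rintro rfl; exact hr hm.symm
  have hconst : ∀ b : Bool, m ∈ Multiset.map (fun _ : Unit => b) '' {m | m ≠ 0} ↔ (!b) ∉ m := by
    intro b
    constructor
    · rintro ⟨m, -, rfl⟩
      cases b <;> simp [Multiset.mem_replicate]
    · intro h
      refine ⟨Multiset.replicate r (), ?_, ?_⟩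
      · simpa [← Multiset.card_eq_zero] using hr
      · rw [Multiset.map_replicate, eq_comm, Multiset.eq_replicate]
        refine ⟨hm, fun c hc => ?_⟩
        by_contra hcb
        have : c = !b := by cases b <;> cases c <;> simp_all
        exact h (this ▸ hc)
  simp only [Set.mem_compl_iff, Set.mem_union, hconst, Set.mem_ofPred_eq]
  simp [and_comm]

lemma exists_isGreatest_Icc {f : ℝ → ℝ} (hf : Continuous f) :
    ∃ M, IsGreatest (f '' Set.Icc 0 1) M := by
  obtain ⟨x, hx, hmax⟩ := isCompact_Icc.exists_isMaxOn (Set.nonempty_Icc.2 zero_le_one)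
    (hf.continuousOn (s := Set.Icc (0 : ℝ) 1))
  exact ⟨_, ⟨x, hx, rfl⟩, by rintro _ ⟨v, hv, rfl⟩; exact hmax hv⟩

lemma IsLag.join (hr : r ≠ 0) (hβ : IsLag r β) (hγ : IsLag r γ) {M : ℝ}
    (hM : IsGreatest ((fun x : ℝ => 1 - (1 - β) * x ^ r - (1 - γ) * (1 - x) ^ r) ''
      Set.Icc 0 1) M) : IsLag r M := by
  refine hβ.binary hr hγ (P := {m | true ∈ m ∧ false ∈ m}) (fun m hm => hm) ?_
  convert hM using 3 with x
  rw [patPoly_both_sides hr]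
  simp only [cond_true, cond_false, add_sub_cancel, one_pow]
  ring

lemma IsLag.cover (hβ : IsLag 3 β) (hγ : IsLag 3 γ) {M : ℝ}
    (hM : IsGreatest ((fun x : ℝ => 3 * x * (1 - x) ^ 2 + γ * (1 - x) ^ 3 + β * x ^ 3) ''
      Set.Icc 0 1) M) : IsLag 3 M := by
  have hi : Function.Injective fun _ : Unit => false := fun _ _ _ => rfl
  refine hβ.binary three_ne_zero hγ
    (P := (fun m : Multiset Unit => true ::ₘ m.map fun _ => false) '' {m | m.card = 2}) ?_ ?_
  · rintro _ ⟨m, hm, rfl⟩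
    have : m ≠ 0 := by rintro rfl; simp at hm
    simpa [Multiset.eq_zero_iff_forall_notMem, Multiset.mem_replicate] using this
  · convert hM using 2 with x
    rw [patPoly_image_cons_map (r := 2) hi (by simp), patPoly_congr (E' := Set.univ) (by simp),
      patPoly_univ]
    simp
    ring

lemma isLag_one : IsLag r 1 :=
  ⟨Unit, inferInstance, Set.univ, ⟨fun _ => 1, ⟨by simp, by simp⟩, by simp [patPoly_univ]⟩, by
    rintro _ ⟨w, hw, rfl⟩; rw [patPoly_univ, hw.2, one_pow]⟩

/-- The factor by which adding a cone vertex rescales Lagrangians. -/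
noncomputable def coneFactor (r : ℕ) : ℝ := ((r : ℝ) / (r + 1)) ^ r

lemma coneFactor_isGreatest (hr : r ≠ 0) :
    IsGreatest ((fun y : ℝ => (r + 1) * y * (1 - y) ^ r) '' Set.Icc 0 1) (coneFactor r) := by
  have hr0 : (0 : ℝ) < r := by exact_mod_cast Nat.pos_of_ne_zero hr
  have hc : 0 < (r : ℝ) / (r + 1) := by positivity
  constructor
  · refine ⟨1 / (r + 1), ⟨by positivity, ?_⟩, ?_⟩
    · rw [div_le_one (by positivity)]
      linarith
    · have : 1 - 1 / ((r : ℝ) + 1) = r / (r + 1) := by field_simp; ring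
      simp only [this, coneFactor]
      field_simp
  · rintro _ ⟨y, hy, rfl⟩
    simp only [coneFactor]
    set c := (r : ℝ) / (r + 1) with hcdef
    have hcr : c * (r + 1) = r := by rw [hcdef]; field_simp
    obtain ⟨z, rfl⟩ : ∃ z, y = 1 - z := ⟨1 - y, by ring⟩
    rw [sub_sub_cancel]
    rcases (sub_le_self_iff 1).1 hy.2 |>.eq_or_lt with h0 | h0
    · rw [← h0, zero_pow hr, mul_zero]
      positivity
    · have hb := one_add_mul_le_pow (a := c / z - 1) (by
        have : 0 < c / z := by positivity
        linarith) (r + 1)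
      rw [add_sub_cancel, div_pow, le_div_iff₀ (by positivity)] at hb
      have h1 : (1 + ((r + 1 : ℕ) : ℝ) * (c / z - 1)) * z ^ (r + 1) =
          c * ((r + 1) * (1 - z) * z ^ r) := by
        push_cast
        have : c / z * z = c := by field_simp
        calc _ = z ^ r * (z + (r + 1) * (c / z * z - z)) := by ring
          _ = _ := by rw [this]; linear_combination z ^ r * z * hcr
      rw [h1, pow_succ' c] at hb
      exact le_of_mul_le_mul_left hb hc

lemma IsLag.cone (hr : r ≠ 0) (hβ : IsLag r β) : IsLag (r + 1) (coneFactor r * β) := by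
  classical
  have hβ0 := hβ.nonneg
  obtain ⟨V, _, E, ⟨w, hw, hβw⟩, hmax⟩ := hβ
  have hle : ∀ w ∈ stdSimplex ℝ V, patPoly r E w ≤ β := fun w hw => hmax ⟨w, hw, rfl⟩
  have hpoly : ∀ w : Option V → ℝ,
      patPoly (r + 1) ((fun m => none ::ₘ m.map some) '' E) w =
        (r + 1) * w none * patPoly r E (w ∘ some) := fun w =>
    patPoly_image_cons_map (Option.some_injective V) (by simp) E w
  obtain ⟨⟨y, hy, hyc⟩, hcmax⟩ := coneFactor_isGreatest hr
  refine ⟨Option V, inferInstance, (fun m => none ::ₘ m.map some) '' E, ?_, ?_⟩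
  · refine ⟨fun o => o.elim y fun v => (1 - y) * w v, ⟨?_, ?_⟩, ?_⟩
    · rintro (_ | v)
      · exact hy.1
      · exact mul_nonneg (by linarith [hy.2]) (hw.1 v)
    · rw [Fintype.sum_option]
      simp [← Finset.mul_sum, hw.2]
    · rw [hpoly, ← hyc]
      simp only [Function.comp_def, Option.elim, patPoly_smul, hβw]
      ring
  · rintro _ ⟨w, hw, rfl⟩
    rw [hpoly]
    have hs := hw.2
    rw [Fintype.sum_option] at hs
    have h1 := patPoly_le_mul_pow hr hle (w := w ∘ some) fun v => hw.1 _
    have h0 : ∑ v, w (some v) = 1 - w none := by linarith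
    simp only [Function.comp, h0] at h1
    have hn : 0 ≤ 1 - w none := h0 ▸ Finset.sum_nonneg fun v _ => hw.1 _
    have h3 := hcmax ⟨w none, ⟨hw.1 _, by linarith⟩, rfl⟩
    simp only at h3
    calc _ ≤ (r + 1) * w none * (β * (1 - w none) ^ r) :=
          mul_le_mul_of_nonneg_left h1 (mul_nonneg (by positivity) (hw.1 _))
      _ = ((r + 1) * w none * (1 - w none) ^ r) * β := by ring
      _ ≤ _ := mul_le_mul_of_nonneg_right h3 hβ0

end Operations

section Join

variable {N : ℕ}

lemma IsLag.lagLimit {r : ℕ} {y : ℝ} (h : IsLag r y) : LagLimit r y :=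
  fun ε hε => ⟨y, h, by linarith, le_rfl⟩

lemma one_div_pow_add_le {m₁ m₂ x : ℝ} (h₁ : 0 < m₁) (h₂ : 0 < m₂) (hx : x ∈ Set.Icc (0 : ℝ) 1) :
    1 / (m₁ + m₂) ^ N ≤ 1 / m₁ ^ N * x ^ (N + 1) + 1 / m₂ ^ N * (1 - x) ^ (N + 1) := by
  set T := m₁ + m₂ with hT
  have hT0 : 0 < T := by positivity
  have hx0 : 0 ≤ x := hx.1
  have hx1 : 0 ≤ 1 - x := by linarith [hx.2]
  have key : ∀ {m z : ℝ}, 0 < m → 0 ≤ z →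
      (m + (N + 1) * (z * T - m)) / T ^ (N + 1) ≤ 1 / m ^ N * z ^ (N + 1) := by
    intro m z hm hz
    have hb := one_add_mul_le_pow (a := z * T / m - 1) (by
      have : 0 ≤ z * T / m := by positivity
      linarith) (N + 1)
    rw [add_sub_cancel] at hb
    rw [div_le_iff₀ (by positivity)]
    calc m + (N + 1) * (z * T - m) = m * (1 + ((N + 1 : ℕ) : ℝ) * (z * T / m - 1)) := by
          push_cast; field_simp
      _ ≤ m * (z * T / m) ^ (N + 1) := mul_le_mul_of_nonneg_left hb hm.le
      _ = _ := by rw [div_pow, mul_pow, pow_succ m]; field_simp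
  refine le_trans (le_of_eq ?_) (add_le_add (key h₁ hx0) (key h₂ hx1))
  rw [← add_div, div_eq_div_iff (by positivity) (by positivity), hT]
  ring

lemma one_div_pow_add_eq {m₁ m₂ : ℝ} (h₁ : 0 < m₁) (h₂ : 0 < m₂) :
    1 / m₁ ^ N * (m₁ / (m₁ + m₂)) ^ (N + 1) + 1 / m₂ ^ N * (1 - m₁ / (m₁ + m₂)) ^ (N + 1) =
      1 / (m₁ + m₂) ^ N := by
  have : 1 - m₁ / (m₁ + m₂) = m₂ / (m₁ + m₂) := by field_simp; ring
  rw [this, div_pow, div_pow]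
  field_simp
  ring

lemma LagLimit.join {m₁ m₂ : ℝ} (h₁ : 0 < m₁) (h₂ : 0 < m₂)
    (hm₁ : LagLimit (N + 1) (1 - 1 / m₁ ^ N)) (hm₂ : LagLimit (N + 1) (1 - 1 / m₂ ^ N)) :
    LagLimit (N + 1) (1 - 1 / (m₁ + m₂) ^ N) := by
  intro ε hε
  obtain ⟨s₁, hs₁, hl₁, hu₁⟩ := hm₁ (ε / 2) (by linarith)
  obtain ⟨s₂, hs₂, hl₂, hu₂⟩ := hm₂ (ε / 2) (by linarith)
  obtain ⟨M, hM⟩ := exists_isGreatest_Icc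
    (f := fun x : ℝ => 1 - (1 - s₁) * x ^ (N + 1) - (1 - s₂) * (1 - x) ^ (N + 1)) (by fun_prop)
  refine ⟨M, hs₁.join N.succ_ne_zero hs₂ hM, ?_, ?_⟩
  · have hx : m₁ / (m₁ + m₂) ∈ Set.Icc (0 : ℝ) 1 :=
      ⟨by positivity, by rw [div_le_one (by positivity)]; linarith⟩
    have h := hM.2 ⟨_, hx, rfl⟩
    have he := one_div_pow_add_eq (N := N) h₁ h₂
    simp only at h
    set x := m₁ / (m₁ + m₂)
    have hx1 : 0 ≤ 1 - x := by linarith [hx.2]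
    have e1 : x ^ (N + 1) ≤ 1 := pow_le_one₀ hx.1 hx.2
    have e2 : (1 - x) ^ (N + 1) ≤ 1 := pow_le_one₀ hx1 (by linarith [hx.1])
    have e3 : 0 ≤ x ^ (N + 1) := pow_nonneg hx.1 _
    have e4 : 0 ≤ (1 - x) ^ (N + 1) := pow_nonneg hx1 _
    have e5 : x ^ (N + 1) + (1 - x) ^ (N + 1) ≤ 1 := by
      have h5 : x ^ (N + 1) ≤ x := pow_le_of_le_one hx.1 hx.2 N.succ_ne_zero
      have h6 : (1 - x) ^ (N + 1) ≤ 1 - x :=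
        pow_le_of_le_one hx1 (by linarith [hx.1]) N.succ_ne_zero
      linarith
    have e6 : 0 < x := by positivity
    have e7 : 0 < x ^ (N + 1) := by positivity
    have e8 : (1 - s₁) * x ^ (N + 1) ≤ (1 / m₁ ^ N + ε / 2) * x ^ (N + 1) :=
      mul_le_mul_of_nonneg_right (by linarith) e3
    have e9 : (1 - s₂) * (1 - x) ^ (N + 1) ≤ (1 / m₂ ^ N + ε / 2) * (1 - x) ^ (N + 1) :=
      mul_le_mul_of_nonneg_right (by linarith) e4
    nlinarith
  · obtain ⟨x, hx, rfl⟩ := hM.1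
    have h := one_div_pow_add_le (N := N) h₁ h₂ hx
    have hx1 : 0 ≤ 1 - x := by linarith [hx.2]
    have e3 : 0 ≤ x ^ (N + 1) := pow_nonneg hx.1 _
    have e4 : 0 ≤ (1 - x) ^ (N + 1) := pow_nonneg hx1 _
    have e8 : (1 / m₁ ^ N) * x ^ (N + 1) ≤ (1 - s₁) * x ^ (N + 1) :=
      mul_le_mul_of_nonneg_right (by linarith) e3
    have e9 : (1 / m₂ ^ N) * (1 - x) ^ (N + 1) ≤ (1 - s₂) * (1 - x) ^ (N + 1) :=
      mul_le_mul_of_nonneg_right (by linarith) e4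
    simp only
    linarith

lemma LagLimit.nsmul {m : ℝ} (h : 0 < m) (hm : LagLimit (N + 1) (1 - 1 / m ^ N)) (k : ℕ) :
    LagLimit (N + 1) (1 - 1 / ((k + 1 : ℕ) * m) ^ N) := by
  induction k with
  | zero => simpa using hm
  | succ k ih =>
    have := LagLimit.join (by positivity) h ih hm
    convert this using 4
    push_cast
    ring

/-- An interval of limits of Lagrangians forces a terminal interval of such limits. -/
theorem exists_terminal_interval (hN : N ≠ 0) {α β : ℝ} (hαβ : α < β) (hβ : β ≤ 1)
    (h : ∀ y ∈ Set.Icc α β, LagLimit (N + 1) y) :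
    ∃ δ : ℝ, 0 < δ ∧ ∀ y ∈ Set.Icc (1 - δ) 1, LagLimit (N + 1) y := by
  obtain ⟨β', hβ'1, hβ'2⟩ := exists_between hαβ
  have hroot : ∀ v : ℝ, v < 1 → ∃ m : ℝ, 0 < m ∧ v = 1 - 1 / m ^ N := by
    intro v hv
    have h0 : 0 < (1 - v)⁻¹ := inv_pos.2 (by linarith)
    refine ⟨(1 - v)⁻¹ ^ ((N : ℝ)⁻¹), Real.rpow_pos_of_pos h0 _, ?_⟩
    rw [Real.rpow_inv_natCast_pow h0.le hN]
    simp
  obtain ⟨a, ha, hav⟩ := hroot α (by linarith)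
  obtain ⟨b, hb, hbv⟩ := hroot β' (by linarith)
  have hab : a < b := by
    have h1 : 1 / b ^ N < 1 / a ^ N := by linarith
    rw [one_div_lt_one_div (by positivity) (by positivity)] at h1
    exact lt_of_pow_lt_pow_left₀ N hb.le h1
  have hQ : ∀ m ∈ Set.Icc a b, LagLimit (N + 1) (1 - 1 / m ^ N) := by
    intro m hm
    have hm0 : 0 < m := ha.trans_le hm.1
    refine h _ ⟨?_, ?_⟩
    · have : 1 / m ^ N ≤ 1 / a ^ N := by gcongr; exact hm.1
      linarith
    · have : 1 / b ^ N ≤ 1 / m ^ N := by gcongr; exact hm.2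
      linarith
  obtain ⟨K, hK⟩ := exists_nat_gt (a / (b - a))
  have hba : 0 < b - a := by linarith
  rw [div_lt_iff₀ hba] at hK
  have hlarge : ∀ m : ℝ, ((K + 1 : ℕ) : ℝ) * a ≤ m → LagLimit (N + 1) (1 - 1 / m ^ N) := by
    intro m hm
    have h1 : K + 1 ≤ ⌊m / a⌋₊ := Nat.le_floor ((le_div_iff₀ ha).2 hm)
    obtain ⟨k, hk⟩ : ∃ k, ⌊m / a⌋₊ = k + 1 := ⟨⌊m / a⌋₊ - 1, by omega⟩
    have hm0 : 0 ≤ m / a := le_trans (by positivity) ((le_div_iff₀ ha).2 hm)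
    have h2 : ((k + 1 : ℕ) : ℝ) ≤ m / a := hk ▸ Nat.floor_le hm0
    have h3 : m / a < ((k + 1 : ℕ) : ℝ) + 1 := by
      have := Nat.lt_floor_add_one (m / a); rwa [hk] at this
    have hKk : (K : ℝ) ≤ ((k + 1 : ℕ) : ℝ) := by exact_mod_cast (by omega : K ≤ k + 1)
    rw [le_div_iff₀ ha] at h2
    rw [div_lt_iff₀ ha] at h3
    have hk0 : (0 : ℝ) < ((k + 1 : ℕ) : ℝ) := by positivity
    have hmem : m / ((k + 1 : ℕ) : ℝ) ∈ Set.Icc a b := by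
      constructor
      · rw [le_div_iff₀ hk0]; linarith
      · rw [div_le_iff₀ hk0]; nlinarith
    have := LagLimit.nsmul (ha.trans_le hmem.1) (hQ _ hmem) k
    rwa [mul_div_cancel₀ _ hk0.ne'] at this
  refine ⟨1 / (((K + 1 : ℕ) : ℝ) * a) ^ N, by positivity, fun y hy => ?_⟩
  rcases hy.2.eq_or_lt with rfl | hy1
  · exact isLag_one.lagLimit
  · obtain ⟨m, hm, rfl⟩ := hroot y hy1
    refine hlarge m ?_
    have h1 : 1 / m ^ N ≤ 1 / (((K + 1 : ℕ) : ℝ) * a) ^ N := by linarith [hy.1]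
    rw [one_div_le_one_div (by positivity) (by positivity)] at h1
    exact le_of_pow_le_pow_left₀ hN hm.le h1

end Join

section Cone

lemma coneFactor_pos {r : ℕ} (hr : r ≠ 0) : 0 < coneFactor r := by
  have : (0 : ℝ) < r := by exact_mod_cast Nat.pos_of_ne_zero hr
  unfold coneFactor
  positivity

lemma LagLimit.cone {r : ℕ} (hr : r ≠ 0) {y : ℝ} (h : LagLimit r y) :
    LagLimit (r + 1) (coneFactor r * y) := by
  intro ε hε
  have hc := coneFactor_pos hr
  obtain ⟨s, hs, h1, h2⟩ := h (ε / coneFactor r) (by positivity)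
  refine ⟨_, hs.cone hr, ?_, mul_le_mul_of_nonneg_left h2 hc.le⟩
  have := mul_lt_mul_of_pos_left h1 hc
  rw [mul_sub, mul_div_cancel₀ _ hc.ne'] at this
  exact this

/-- An interval of limits of `3`-uniform Lagrangians yields one in every larger uniformity. -/
theorem exists_interval_of_three {α β : ℝ} (hαβ : α < β)
    (h : ∀ y ∈ Set.Icc α β, LagLimit 3 y) {r : ℕ} (hr : 3 ≤ r) :
    ∃ α β : ℝ, α < β ∧ ∀ y ∈ Set.Icc α β, LagLimit r y := by
  induction r, hr using Nat.le_induction with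
  | base => exact ⟨α, β, hαβ, h⟩
  | succ r hr ih =>
    obtain ⟨α, β, hαβ, h⟩ := ih
    have hr0 : r ≠ 0 := by omega
    have hc := coneFactor_pos hr0
    refine ⟨coneFactor r * α, coneFactor r * β, mul_lt_mul_of_pos_left hαβ hc, fun y hy => ?_⟩
    have := LagLimit.cone hr0 (h (y / coneFactor r)
      ⟨(le_div_iff₀ hc).2 (by linarith [hy.1]), (div_le_iff₀ hc).2 (by linarith [hy.2])⟩)
    rwa [mul_div_cancel₀ _ hc.ne'] at this

lemma LagLimit.le_one {r : ℕ} {y : ℝ} (h : LagLimit r y) : y ≤ 1 := by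
  by_contra! hy
  obtain ⟨s, hs, h1, -⟩ := h (y - 1) (by linarith)
  linarith [hs.le_one]

theorem terminal_interval_of_three {α β : ℝ} (hαβ : α < β)
    (h : ∀ y ∈ Set.Icc α β, LagLimit 3 y) (r : ℕ) (hr : 3 ≤ r) :
    ∃ δ : ℝ, 0 < δ ∧ Set.Icc (1 - δ) 1 ⊆ PiInf r := by
  obtain ⟨α, β, hαβ, h⟩ := exists_interval_of_three hαβ h hr
  obtain ⟨N, rfl⟩ : ∃ N, r = N + 1 := ⟨r - 1, by omega⟩
  obtain ⟨δ, hδ, hδ'⟩ := exists_terminal_interval (by omega) hαβ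
    (h β ⟨hαβ.le, le_rfl⟩).le_one h
  exact ⟨δ, hδ, fun y hy => (hδ' y hy).mem_PiInf N.succ_ne_zero⟩

end Cone

section CoverMap

/-- The polynomial maximised by the pattern operation `IsLag.cover`. -/
noncomputable def coverPoly (γ β x : ℝ) : ℝ := 3 * x * (1 - x) ^ 2 + γ * (1 - x) ^ 3 + β * x ^ 3

/-- The value of the pattern operation `IsLag.cover`. -/
noncomputable def coverMap (γ β : ℝ) : ℝ := sSup (coverPoly γ β '' Set.Icc 0 1)

/-- The function whose maximum is the least fixed point of `coverMap γ`. -/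
noncomputable def fixFun (γ x : ℝ) : ℝ := (1 - x) * (3 * x + γ * (1 - x)) / (1 + x + x ^ 2)

/-- The least fixed point of `coverMap γ`. -/
noncomputable def fixPt (γ : ℝ) : ℝ := sSup (fixFun γ '' Set.Icc 0 1)

variable {γ γ' β β' x : ℝ}

lemma coverMap_isGreatest (γ β : ℝ) :
    IsGreatest (coverPoly γ β '' Set.Icc 0 1) (coverMap γ β) := by
  obtain ⟨M, hM⟩ := exists_isGreatest_Icc (f := coverPoly γ β) (by unfold coverPoly; fun_prop)
  rw [coverMap, hM.csSup_eq]
  exact hM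

lemma fixPt_isGreatest (γ : ℝ) : IsGreatest (fixFun γ '' Set.Icc 0 1) (fixPt γ) := by
  have hc : ContinuousOn (fixFun γ) (Set.Icc 0 1) := by
    unfold fixFun
    refine ContinuousOn.div (by fun_prop) (by fun_prop) fun x hx => ?_
    have := hx.1
    positivity
  obtain ⟨x, hx, hmax⟩ := isCompact_Icc.exists_isMaxOn (Set.nonempty_Icc.2 zero_le_one) hc
  have hM : IsGreatest (fixFun γ '' Set.Icc 0 1) (fixFun γ x) :=
    ⟨⟨x, hx, rfl⟩, by rintro _ ⟨v, hv, rfl⟩; exact hmax hv⟩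
  rw [fixPt, hM.csSup_eq]
  exact hM

lemma IsLag.coverMap (hβ : IsLag 3 β) (hγ : IsLag 3 γ) : IsLag 3 (coverMap γ β) :=
  hβ.cover hγ (coverMap_isGreatest γ β)

lemma le_coverMap (hx : x ∈ Set.Icc (0 : ℝ) 1) : coverPoly γ β x ≤ coverMap γ β :=
  (coverMap_isGreatest γ β).2 ⟨x, hx, rfl⟩

lemma le_fixPt (hx : x ∈ Set.Icc (0 : ℝ) 1) : fixFun γ x ≤ fixPt γ :=
  (fixPt_isGreatest γ).2 ⟨x, hx, rfl⟩

lemma coverPoly_eq (hx : x ∈ Set.Icc (0 : ℝ) 1) :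
    coverPoly γ β x = β + (1 - x ^ 3) * (fixFun γ x - β) := by
  have : (1 + x + x ^ 2) ≠ 0 := by have := hx.1; positivity
  unfold coverPoly fixFun
  field_simp
  ring

lemma one_sub_cube_nonneg (hx : x ∈ Set.Icc (0 : ℝ) 1) : 0 ≤ 1 - x ^ 3 :=
  sub_nonneg.2 (pow_le_one₀ hx.1 hx.2)

lemma self_le_coverMap : β ≤ coverMap γ β := by
  have := le_coverMap (γ := γ) (β := β) (x := 1) ⟨zero_le_one, le_rfl⟩
  simpa [coverPoly] using this

lemma coverMap_fixPt : coverMap γ (fixPt γ) = fixPt γ := by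
  refine le_antisymm ?_ self_le_coverMap
  obtain ⟨x, hx, h⟩ := (coverMap_isGreatest γ (fixPt γ)).1
  rw [← h, coverPoly_eq hx]
  nlinarith [one_sub_cube_nonneg hx, le_fixPt (γ := γ) hx]

lemma coverMap_mono (h : β ≤ β') : coverMap γ β ≤ coverMap γ β' := by
  obtain ⟨x, hx, hm⟩ := (coverMap_isGreatest γ β).1
  rw [← hm]
  refine le_trans ?_ (le_coverMap hx)
  unfold coverPoly
  have := pow_nonneg hx.1 3
  nlinarith

lemma coverMap_le_add (h : β ≤ β') : coverMap γ β' ≤ coverMap γ β + (β' - β) := by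
  obtain ⟨x, hx, hm⟩ := (coverMap_isGreatest γ β').1
  have h1 := le_coverMap (γ := γ) (β := β) hx
  rw [← hm]
  unfold coverPoly at *
  nlinarith [one_sub_cube_nonneg hx]

lemma continuous_coverMap (γ : ℝ) : Continuous (coverMap γ) := by
  have : LipschitzWith 1 (coverMap γ) := by
    refine LipschitzWith.of_le_add fun β β' => ?_
    rcases le_total β β' with h | h
    · exact (coverMap_mono h).trans (le_add_of_nonneg_right dist_nonneg)
    · rw [Real.dist_eq, abs_of_nonneg (sub_nonneg.2 h)]
      exact coverMap_le_add h
  exact this.continuous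

lemma coverMap_le_add_param {δ : ℝ} (hδ : 0 ≤ δ) (h : γ ≤ γ' + δ) :
    coverMap γ β ≤ coverMap γ' β + δ := by
  obtain ⟨x, hx, hm⟩ := (coverMap_isGreatest γ β).1
  have h1 := le_coverMap (γ := γ') (β := β) hx
  rw [← hm]
  have h2 : (1 - x) ^ 3 ≤ 1 := pow_le_one₀ (by linarith [hx.2]) (by linarith [hx.1])
  have h3 : 0 ≤ (1 - x) ^ 3 := pow_nonneg (by linarith [hx.2]) 3
  unfold coverPoly at *
  nlinarith

lemma fixPt_le_one (hγ : γ ≤ 1) : fixPt γ ≤ 1 := by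
  obtain ⟨x, hx, hm⟩ := (fixPt_isGreatest γ).1
  have hx0 := hx.1
  have hx1 : 0 ≤ 1 - x := by linarith [hx.2]
  rw [← hm, fixFun, div_le_one (by positivity)]
  nlinarith [mul_nonneg hx1 hx1, mul_nonneg hx0 hx0]

lemma lt_fixPt (h0 : 0 ≤ γ) (h1 : γ < 1) : γ < fixPt γ := by
  refine lt_of_lt_of_le ?_ (le_fixPt (γ := γ) (x := (1 - γ) / 2) ⟨by linarith, by linarith⟩)
  have hx : 0 < (1 - γ) / 2 := by linarith
  rw [fixFun, lt_div_iff₀ (by positivity)]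
  nlinarith [mul_pos hx hx]

lemma fixPt_le_add (h : γ ≤ γ') : fixPt γ' ≤ fixPt γ + (γ' - γ) := by
  obtain ⟨x, hx, hm⟩ := (fixPt_isGreatest γ').1
  have h1 := le_fixPt (γ := γ) hx
  have hx0 := hx.1
  have hx1 : 0 ≤ 1 - x := by linarith [hx.2]
  have h2 : fixFun γ' x ≤ fixFun γ x + (γ' - γ) := by
    have hp : 0 < 1 + x + x ^ 2 := by positivity
    unfold fixFun
    rw [← sub_le_iff_le_add', ← sub_div, div_le_iff₀ hp]
    nlinarith [mul_nonneg (sub_nonneg.2 h) hx0]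
  linarith

lemma exists_fixPt_ge (hγ : 0 < γ) : ∃ c : ℝ, 0 < c ∧ ∀ γ', γ ≤ γ' →
    fixPt γ + c * (γ' - γ) ≤ fixPt γ' := by
  obtain ⟨x, hx, hm⟩ := (fixPt_isGreatest γ).1
  have hx0 := hx.1
  have hp : 0 < 1 + x + x ^ 2 := by positivity
  have hx1 : x < 1 := by
    refine lt_of_le_of_ne hx.2 ?_
    rintro rfl
    have := le_fixPt (γ := γ) (x := 0) ⟨le_rfl, zero_le_one⟩
    rw [← hm] at this
    norm_num [fixFun] at this
    linarith
  have h1 : 0 < 1 - x := by linarith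
  refine ⟨(1 - x) ^ 2 / (1 + x + x ^ 2), by positivity, fun γ' h => ?_⟩
  refine le_trans (le_of_eq ?_) (le_fixPt hx)
  rw [← hm]
  unfold fixFun
  field_simp
  ring

lemma fixFun_le (hγ : γ ≤ 1) (hx : x ∈ Set.Icc (0 : ℝ) 1) : fixFun γ x ≤ 3 * (1 - x) := by
  have hx0 := hx.1
  have hx1 : 0 ≤ 1 - x := by linarith [hx.2]
  have hp : 0 < 1 + x + x ^ 2 := by positivity
  unfold fixFun
  rw [mul_div_assoc, mul_comm (3 : ℝ) (1 - x)]
  refine mul_le_mul_of_nonneg_left ?_ hx1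
  rw [div_le_iff₀ hp]
  nlinarith

lemma coverMap_contraction {γ₀ : ℝ} (hγ : γ ≤ 1) (h0 : γ₀ ≤ β) (h : β ≤ β')
    (h' : β' ≤ fixPt γ) :
    coverMap γ β' - coverMap γ β ≤ (1 - γ₀ / 3) ^ 3 * (β' - β) := by
  obtain ⟨x, hx, hm, hle⟩ : ∃ x ∈ Set.Icc (0 : ℝ) 1, coverPoly γ β' x = coverMap γ β' ∧
      β' ≤ fixFun γ x := by
    rcases (self_le_coverMap (γ := γ) (β := β')).eq_or_lt with heq | hlt
    · obtain ⟨x, hx, hm⟩ := (fixPt_isGreatest γ).1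
      refine ⟨x, hx, le_antisymm (le_coverMap hx) ?_, hm ▸ h'⟩
      rw [← heq, coverPoly_eq hx, hm]
      nlinarith [one_sub_cube_nonneg hx]
    · obtain ⟨x, hx, hm⟩ := (coverMap_isGreatest γ β').1
      refine ⟨x, hx, hm, ?_⟩
      by_contra! hc
      rw [← hm, coverPoly_eq hx] at hlt
      nlinarith [one_sub_cube_nonneg hx]
  have hx1 : x ≤ 1 - γ₀ / 3 := by linarith [fixFun_le hγ hx]
  have h1 := le_coverMap (γ := γ) (β := β) hx
  have h2 : x ^ 3 ≤ (1 - γ₀ / 3) ^ 3 := pow_le_pow_left₀ hx.1 hx1 3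
  have h3 : coverMap γ β' - coverMap γ β ≤ x ^ 3 * (β' - β) := by
    rw [← hm]
    unfold coverPoly at *
    linarith
  exact h3.trans (mul_le_mul_of_nonneg_right h2 (sub_nonneg.2 h))

lemma coverMap_gap {γ₀ ξ a : ℝ} (hγ0 : 0 ≤ γ) (ha1 : a ≤ 1)
    (hξ : 0 ≤ ξ) (hξa : ξ = (a - γ₀) / 8) (hγγ : γ - γ₀ ≤ (a - γ₀) / 2) (ha : a ≤ fixPt γ) :
    coverMap γ a ≤ fixPt γ - ξ ^ 3 * (fixPt γ - a) := by
  obtain ⟨x, hx, hm⟩ := (coverMap_isGreatest γ a).1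
  have hx0 := hx.1
  have hx1 : 0 ≤ 1 - x := by linarith [hx.2]
  have hle : a ≤ coverPoly γ a x := hm ▸ self_le_coverMap
  have hxξ : ξ ≤ x := by
    have h1 : coverPoly γ a x ≤ γ + 4 * x := by
      have e1 : (1 - x) ^ 2 ≤ 1 := pow_le_one₀ hx1 (by linarith)
      have e2 : (1 - x) ^ 3 ≤ 1 := pow_le_one₀ hx1 (by linarith)
      have e3 : x ^ 3 ≤ x := pow_le_of_le_one hx.1 hx.2 three_ne_zero
      have e4 : x * (1 - x) ^ 2 ≤ x * 1 := mul_le_mul_of_nonneg_left e1 hx0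
      have e5 : γ * (1 - x) ^ 3 ≤ γ * 1 := mul_le_mul_of_nonneg_left e2 hγ0
      have e6 : a * x ^ 3 ≤ 1 * x := mul_le_mul ha1 e3 (pow_nonneg hx0 3) zero_le_one
      unfold coverPoly
      linarith
    linarith
  have h3 : ξ ^ 3 ≤ x ^ 3 := pow_le_pow_left₀ hξ hxξ 3
  rw [← hm, coverPoly_eq hx]
  nlinarith [one_sub_cube_nonneg hx, le_fixPt (γ := γ) hx,
    mul_le_mul_of_nonneg_right h3 (sub_nonneg.2 ha),
    mul_le_mul_of_nonneg_left (sub_le_sub_right (le_fixPt (γ := γ) hx) a) (one_sub_cube_nonneg hx)]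

/-- A slowly converging sequence of Lagrangians yields an interval of limits of Lagrangians. -/
theorem exists_interval_of_seq {γ₀ : ℝ} {g : ℕ → ℝ} (h0 : 0 < γ₀) (h1 : γ₀ < 1)
    (hγ₀ : IsLag 3 γ₀) (hg : ∀ k, IsLag 3 (g k)) (hlt : ∀ k, γ₀ < g k)
    (hlim : Tendsto g atTop (nhds γ₀))
    (hratio : Tendsto (fun k => (g k - γ₀) / (g (k + 1) - γ₀)) atTop (nhds 1)) :
    ∃ α β : ℝ, α < β ∧ ∀ y ∈ Set.Icc α β, LagLimit 3 y := by
  set a := fixPt γ₀ with ha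
  have hγa : γ₀ < a := lt_fixPt h0.le h1
  have ha1 : a ≤ 1 := fixPt_le_one h1.le
  obtain ⟨c, hc, hcle⟩ := exists_fixPt_ge h0
  set ξ := (a - γ₀) / 8 with hξ
  have hξ0 : 0 < ξ := by rw [hξ]; linarith
  obtain ⟨k₀, hk₀⟩ : ∃ k₀, ∀ k ≥ k₀, g (k + 1) - γ₀ ≤ (a - γ₀) / 2 ∧
      (g k - γ₀) / (g (k + 1) - γ₀) < 1 + ξ ^ 3 * c := by
    have e1 : ∀ᶠ k in atTop, g (k + 1) < γ₀ + (a - γ₀) / 2 :=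
      (tendsto_order.1 (hlim.comp (tendsto_add_atTop_nat 1))).2 _ (by linarith)
    have hpos : 0 < ξ ^ 3 * c := by positivity
    have e2 := (tendsto_order.1 hratio).2 (1 + ξ ^ 3 * c) (by linarith)
    obtain ⟨k₀, h⟩ := eventually_atTop.1 (e1.and e2)
    exact ⟨k₀, fun k hk => ⟨by linarith [(h k hk).1], (h k hk).2⟩⟩
  have hfix : ∀ k, a + c * (g k - γ₀) ≤ fixPt (g k) := fun k => hcle _ (hlt k).le
  have hfixa : ∀ k, a < fixPt (g k) := fun k => by
    have := mul_pos hc (sub_pos.2 (hlt k)); linarith [hfix k]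
  have hchain : ∀ k ≥ k₀, coverMap (g k) a ≤ fixPt (g (k + 1)) := by
    intro k hk
    obtain ⟨e1, e2⟩ := hk₀ k hk
    have hd : 0 < g (k + 1) - γ₀ := sub_pos.2 (hlt _)
    rw [div_lt_iff₀ hd] at e2
    have e3 : coverMap (g k) a ≤ coverMap (g (k + 1)) a + ξ ^ 3 * c * (g (k + 1) - γ₀) :=
      coverMap_le_add_param (by positivity) (by linarith)
    have e4 := coverMap_gap (hg (k + 1)).nonneg ha1 hξ0.le hξ e1
      (hfixa _).le
    have e5 : ξ ^ 3 * (c * (g (k + 1) - γ₀)) ≤ ξ ^ 3 * (fixPt (g (k + 1)) - a) :=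
      mul_le_mul_of_nonneg_left (by linarith [hfix (k + 1)]) (by positivity)
    linarith
  set b := fixPt (g k₀) with hb
  have hb1 : b ≤ 1 := fixPt_le_one (hg _).le_one
  have hdigit : ∀ y ∈ Set.Icc a b, ∃ γ, IsLag 3 γ ∧ γ ≤ 1 ∧ coverMap γ a ≤ y ∧ y ≤ fixPt γ := by
    intro y hy
    rcases hy.1.eq_or_lt with rfl | hay
    · exact ⟨γ₀, hγ₀, h1.le, coverMap_fixPt.le, le_rfl⟩
    · have hex : ∃ k, k₀ ≤ k ∧ fixPt (g k) < y := by
        have e1 := (tendsto_order.1 hlim).2 (γ₀ + (y - a)) (by linarith)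
        obtain ⟨k, hk1, hk2⟩ := (e1.and (eventually_ge_atTop k₀)).exists
        exact ⟨k, hk2, by linarith [fixPt_le_add (hlt k).le]⟩
      classical
      obtain ⟨hk1, hk2⟩ := Nat.find_spec hex
      have hmin := fun m => Nat.find_min hex (m := m)
      set k := Nat.find hex
      have hne : k ≠ k₀ := by
        intro h
        rw [h] at hk2
        linarith [hy.2]
      obtain ⟨j, hj⟩ : ∃ j, k = j + 1 := ⟨k - 1, by omega⟩
      have hjk : k₀ ≤ j := by omega
      have hj2 : y ≤ fixPt (g j) := by
        by_contra! hcon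
        exact hmin j (by omega) ⟨hjk, hcon⟩
      refine ⟨g j, hg j, (hg j).le_one, ?_, hj2⟩
      have := hchain j hjk
      rw [← hj] at this
      linarith
  set κ := (1 - γ₀ / 3) ^ 3 with hκ
  have hκ0 : 0 ≤ κ := pow_nonneg (by linarith) 3
  have hκ1 : κ < 1 := pow_lt_one₀ (by linarith) (by linarith) three_ne_zero
  have happrox : ∀ n : ℕ, ∀ y ∈ Set.Icc a b, ∃ s, IsLag 3 s ∧ γ₀ ≤ s ∧ s ≤ y ∧ y - s ≤ κ ^ n := by
    intro n
    induction n with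
    | zero =>
      intro y hy
      exact ⟨γ₀, hγ₀, le_rfl, by linarith [hy.1], by rw [pow_zero]; linarith [hy.2]⟩
    | succ n ih =>
      intro y hy
      obtain ⟨γ, hγ, hγ1, hlo, hhi⟩ := hdigit y hy
      obtain ⟨y', hy', rfl⟩ := intermediate_value_Icc hy.1 (continuous_coverMap γ).continuousOn
        ⟨hlo, self_le_coverMap⟩
      have hyb : y' ≤ b := hy'.2.trans hy.2
      obtain ⟨s, hs, hs1, hs2, hs3⟩ := ih y' ⟨hy'.1, hyb⟩
      refine ⟨coverMap γ s, hs.coverMap hγ, hs1.trans self_le_coverMap, coverMap_mono hs2, ?_⟩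
      refine (coverMap_contraction hγ1 hs1 hs2 (hy'.2.trans hhi)).trans ?_
      rw [pow_succ' κ n]
      exact mul_le_mul_of_nonneg_left hs3 hκ0
  refine ⟨a, b, hfixa k₀, fun y hy ε hε => ?_⟩
  obtain ⟨n, hn⟩ := exists_pow_lt_of_lt_one hε hκ1
  obtain ⟨s, hs, -, hs2, hs3⟩ := happrox n y hy
  exact ⟨s, hs, by linarith, hs2⟩

end CoverMap

section Digit

variable {A : Type} [Fintype A]

/-- The multisets `{u, v}` with `R u v`. -/
def pairSet (R : A → A → Prop) : Set (Multiset A) := {m | ∃ u v, R u v ∧ m = {u, v}}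

open Classical in
lemma patPoly_pairSet {R : A → A → Prop} (hR : ∀ u v, R u v → R v u) (w : A → ℝ) :
    patPoly 2 (pairSet R) w = ∑ u, ∑ v, if R u v then w u * w v else 0 := by
  unfold patPoly
  rw [← Fintype.sum_prod_type' (f := fun u v => if R u v then w u * w v else 0),
    ← (finTwoArrowEquiv A).sum_comp]
  refine Finset.sum_congr rfl fun t _ => ?_
  have hm : Finset.univ.val.map t = {t 0, t 1} := by
    rw [Fin.univ_val_map]
    simp [List.ofFn_succ]
    rfl
  have : Finset.univ.val.map t ∈ pairSet R ↔ R (t 0) (t 1) := by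
    rw [hm]
    constructor
    · rintro ⟨u, v, h, he⟩
      rw [Multiset.insert_eq_cons, Multiset.insert_eq_cons, Multiset.cons_eq_cons] at he
      rcases he with ⟨h1, h2⟩ | ⟨-, cs, h1, h2⟩
      · rw [Multiset.singleton_inj] at h2
        rwa [h1, h2]
      · rw [Multiset.singleton_eq_cons_iff] at h1 h2
        rw [h1.1, ← h2.1]
        exact hR _ _ h
    · exact fun h => ⟨_, _, h, rfl⟩
  simp only [this, Fin.prod_univ_two]
  rfl

/-- The `3`-multisets which are not edges of the digit pattern of `R` with `L` extra classes. -/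
def digitNonEdge (R : A → A → Prop) (L : ℕ) : Set (Multiset (Option A ⊕ Fin L)) :=
  (Multiset.map Sum.inl '' {m : Multiset (Option A) | m ∉
      (fun m => none ::ₘ m.map some) '' pairSet R}) ∪
    ((⋃ i, Multiset.map (fun _ : Unit => Sum.inr i) '' {m | m.card = 3}) ∪
      ⋃ i, (fun m => Sum.inr i ::ₘ m.map fun u => Sum.inl (some u)) '' pairSet (Eq : A → A → Prop))

open Classical in
lemma patPoly_digit {R : A → A → Prop} (hR : ∀ u v, R u v → R v u) (L : ℕ)
    (w : Option A ⊕ Fin L → ℝ) :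
    patPoly 3 (digitNonEdge R L)ᶜ w = (∑ v, w v) ^ 3 -
      ((∑ v, w (Sum.inl v)) ^ 3 - 3 * w (Sum.inl none) *
        (∑ u, ∑ v, if R u v then w (Sum.inl (some u)) * w (Sum.inl (some v)) else 0) +
      (∑ i, w (Sum.inr i) ^ 3 +
        3 * (∑ i, w (Sum.inr i)) * ∑ u, w (Sum.inl (some u)) ^ 2)) := by
  rw [patPoly_compl, digitNonEdge, patPoly_union, patPoly_union, patPoly_iUnion, patPoly_iUnion]
  · congr 2
    · rw [patPoly_image_map Sum.inl_injective]
      rw [show {m : Multiset (Option A) | m ∉ (fun m => none ::ₘ m.map some) '' pairSet R} =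
        ((fun m => none ::ₘ m.map some) '' pairSet R)ᶜ from rfl, patPoly_compl,
        patPoly_image_cons_map (r := 2) (Option.some_injective A) (by simp),
        patPoly_pairSet hR]
      norm_num
    congr 1
    · refine Finset.sum_congr rfl fun i _ => ?_
      rw [patPoly_image_map (fun _ _ _ => rfl), patPoly_congr (E' := Set.univ) (by simp),
        patPoly_univ]
      simp
    · have h : Function.Injective fun u : A => (Sum.inl (some u) : Option A ⊕ Fin L) :=
        Sum.inl_injective.comp (Option.some_injective A)
      rw [mul_assoc, Finset.sum_mul, Finset.mul_sum]
      refine Finset.sum_congr rfl fun i _ => ?_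
      rw [patPoly_image_cons_map (r := 2) h (by simp), patPoly_pairSet (fun _ _ h => h.symm),
        mul_assoc]
      norm_num
      left
      refine Finset.sum_congr rfl fun u _ => ?_
      simp [pow_two]
  · intro i j hij
    refine Set.disjoint_left.2 ?_
    rintro _ ⟨m, -, rfl⟩ ⟨m', -, h⟩
    beta_reduce at h
    have : Sum.inr i ∈ Sum.inr j ::ₘ m'.map fun u : A => (Sum.inl (some u) : Option A ⊕ Fin L) := by
      rw [h]; simp
    simp at this
    exact hij this
  · intro i j hij
    refine Set.disjoint_left.2 ?_
    rintro _ ⟨m, hm, rfl⟩ ⟨m', -, h⟩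
    obtain ⟨x, hx⟩ := Multiset.card_pos_iff_exists_mem.1 (by rw [hm]; norm_num : 0 < m.card)
    have := Multiset.mem_map_of_mem (fun _ : Unit => (Sum.inr i : Option A ⊕ Fin L)) hx
    rw [← h] at this
    simp [Multiset.mem_replicate] at this
    exact hij this.2
  · rw [Set.disjoint_iUnion_left]
    intro i
    rw [Set.disjoint_iUnion_right]
    intro j
    refine Set.disjoint_left.2 ?_
    rintro _ ⟨m, -, rfl⟩ ⟨_, ⟨u, v, -, rfl⟩, h⟩
    have : Sum.inl (some u) ∈ m.map fun _ : Unit => (Sum.inr i : Option A ⊕ Fin L) := by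
      rw [← h]; simp
    simp [Multiset.mem_replicate] at this
  · rw [Set.disjoint_union_right, Set.disjoint_iUnion_right, Set.disjoint_iUnion_right]
    constructor
    · intro i
      refine Set.disjoint_left.2 ?_
      rintro _ ⟨m', -, rfl⟩ ⟨m, hm, h⟩
      obtain ⟨x, hx⟩ := Multiset.card_pos_iff_exists_mem.1 (by rw [hm]; norm_num : 0 < m.card)
      have := Multiset.mem_map_of_mem (fun _ : Unit => (Sum.inr i : Option A ⊕ Fin L)) hx
      rw [h] at this
      simp at this
    · intro i
      refine Set.disjoint_left.2 ?_
      rintro _ ⟨m', -, rfl⟩ ⟨m, hm, h⟩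
      have : Sum.inr i ∈ m'.map (Sum.inl : Option A → Option A ⊕ Fin L) := by
        rw [← h]; simp
      simp at this

lemma mul_sq_le_cube {s a : ℝ} (hs : 0 ≤ s) (ha : 0 ≤ a) : s * a ^ 2 ≤ 4 / 27 * (s + a) ^ 3 := by
  nlinarith [mul_nonneg (add_nonneg hs (mul_nonneg (by norm_num : (0 : ℝ) ≤ 4) (add_nonneg hs ha)))
    (sq_nonneg (a - 2 * s)), mul_nonneg hs (sq_nonneg (a - 2 * s)),
    mul_nonneg ha (sq_nonneg (a - 2 * s))]

lemma digit_base_le {x r : ℝ} (hr : r = 1 - x) :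
    x ^ 3 + r ^ 3 / 511 ^ 2 = 1 / 512 ^ 2 + 3 * (x - 1 / 512) ^ 2 / 511 +
      (x - 1 / 512) ^ 3 * (1 - 1 / 511 ^ 2) := by
  subst hr
  ring

lemma digit_upper {a b r δ M P Q : ℝ} (ha : 0 ≤ a) (hb : 0 ≤ b) (hr : 0 ≤ r) (hsum : a + b + r = 1)
    (hδ : 0 < δ) (hδ' : δ ≤ 1 / 10 ^ 14) (hM : a ^ 2 * δ ≤ M) (hP : P ≤ 510 * M + 2 * a ^ 2 * δ)
    (hP' : P ≤ a ^ 2 - M) (hQ : r ^ 3 / 511 ^ 2 ≤ Q) :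
    1 - ((a + b) ^ 3 - 3 * b * P + (Q + 3 * r * M)) ≤
      (1 - 1 / 512 ^ 2) + (4 / (9 * 512 ^ 5) + 3 * 10 ^ 7 * δ) * δ := by
  obtain ⟨h, hh⟩ : ∃ h, h = a + b - 1 / 512 := ⟨_, rfl⟩
  have hbase := digit_base_le (x := a + b) (r := r) (by linarith)
  rw [← hh] at hbase
  have hh0 : -(1 / 512) ≤ h := by linarith
  have hh1 : h ≤ 1 := by linarith
  rcases le_or_gt (510 * b) r with hbr | hbr
  · obtain ⟨E, hE⟩ : ∃ E, E = 1 / 512 + 513 * h := ⟨_, rfl⟩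
    have h1 : b * P - r * M ≤ a ^ 2 * (E - 512 * a) * δ := by
      have e1 := mul_le_mul_of_nonneg_left hP hb
      have e2 := mul_le_mul_of_nonneg_left hM (sub_nonneg.2 hbr)
      have e3 : E - 512 * a = 512 * b - r := by rw [hE, hh]; linarith
      rw [e3]
      linarith
    have h2 : a ^ 2 * (E - 512 * a) ≤ 4 / (27 * 512 ^ 2) * ((1 / 512) ^ 3 + 3 * 10 ^ 8 * |h|) := by
      rcases le_or_gt (E - 512 * a) 0 with hE0 | hE0
      · exact (mul_nonpos_of_nonneg_of_nonpos (sq_nonneg a) hE0).trans (by positivity)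
      · have e1 := mul_sq_le_cube hE0.le (by positivity : 0 ≤ 256 * a * 2)
        have e2 : E ^ 3 ≤ (1 / 512) ^ 3 + 3 * 10 ^ 8 * |h| := by
          have e3 : E ≤ 1 / 512 + 513 * |h| := by rw [hE]; linarith [le_abs_self h]
          have e4 : E ^ 3 ≤ (1 / 512 + 513 * |h|) ^ 3 :=
            pow_le_pow_left₀ (by linarith) e3 3
          have e5 : |h| ≤ 1 := abs_le.2 ⟨by linarith, hh1⟩
          have e6 := abs_nonneg h
          have e7 : |h| ^ 2 ≤ |h| := pow_le_of_le_one e6 e5 two_ne_zero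
          have e8 : |h| ^ 3 ≤ |h| := pow_le_of_le_one e6 e5 three_ne_zero
          nlinarith
        nlinarith
    have h3 : 3 * (b * P - r * M) ≤ 4 / (9 * 512 ^ 5) * δ + 600 * |h| * δ := by
      have e1 := mul_le_mul_of_nonneg_right h2 hδ.le
      have e2 : 0 ≤ |h| * δ := by positivity
      linarith
    have h4 : 600 * |h| * δ ≤ 2 * h ^ 2 / 511 + 3 * 10 ^ 7 * δ ^ 2 := by
      have := sq_nonneg (|h| - 76650 * δ)
      have e1 : |h| ^ 2 = h ^ 2 := sq_abs h
      nlinarith [sq_nonneg δ]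
    have h5 : 2 * h ^ 2 / 511 ≤ 3 * h ^ 2 / 511 + h ^ 3 * (1 - 1 / 511 ^ 2) := by
      nlinarith [mul_nonneg (sq_nonneg h) (by linarith : 0 ≤ h + 1 / 512), sq_nonneg h]
    linarith
  · have h1 : 511 * (b * P - r * M) ≤ 2 * δ + (511 * b - r) * a ^ 2 := by
      have e1 := mul_le_mul_of_nonneg_left hP (add_nonneg hb hr)
      have e2 := mul_le_mul_of_nonneg_left hP' (sub_nonneg.2 hbr.le)
      have e3 : (b + r) * (a ^ 2 * δ) ≤ 1 * (1 * δ) := by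
        refine mul_le_mul (by linarith) ?_ (by positivity) zero_le_one
        exact mul_le_mul_of_nonneg_right (pow_le_one₀ ha (by linarith)) hδ.le
      have e4 : 0 ≤ b * a ^ 2 := by positivity
      linarith
    have h2 := mul_sq_le_cube (s := b - r / 511) (by linarith) ha
    have h3 : b - r / 511 + a = 512 / 511 * h := by rw [hh]; linarith
    rw [h3] at h2
    have h4 : 1 / (511 * 512) ≤ h := by rw [hh]; linarith
    have h5 : (1 / (511 * 512)) ^ 2 ≤ h ^ 2 := pow_le_pow_left₀ (by norm_num) h4 2
    have h6 : 0 ≤ h ^ 3 := pow_nonneg (by linarith) 3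
    have h7 : 0 ≤ (4 / (9 * 512 ^ 5) + 3 * 10 ^ 7 * δ) * δ := by positivity
    nlinarith

open Classical in
/-- If `R` is an almost `512`-regular graph whose nontrivial eigenvalues are at most `510`, then the
digit pattern of `R` has Lagrangian close to `1 - 1 / 512 ^ 2`, with a known first order error. -/
lemma exists_digit [Nonempty A] {R : A → A → Prop} (hR : ∀ u v, R u v → R v u)
    (hirr : ∀ u, ¬ R u u) {δ ε : ℝ} (hδ : δ * Fintype.card A = 1) (hδ' : δ ≤ 1 / 10 ^ 14)
    (hε : 0 ≤ ε)
    (hspec : ∀ m : A → ℝ, (∀ u, 0 ≤ m u) → (∑ u, ∑ v, if R u v then m u * m v else 0) ≤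
      510 * ∑ u, m u ^ 2 + 2 * (∑ u, m u) ^ 2 * δ)
    (hdeg : (512 - ε) * Fintype.card A ≤ ∑ u, ∑ v, if R u v then (1 : ℝ) else 0) :
    ∃ γ, IsLag 3 γ ∧ (1 - 1 / 512 ^ 2) + (4 / (9 * 512 ^ 5) - 3 * ε) * δ ≤ γ ∧
      γ ≤ (1 - 1 / 512 ^ 2) + (4 / (9 * 512 ^ 5) + 3 * 10 ^ 7 * δ) * δ := by
  obtain ⟨γ, hγ⟩ := IsLag.exists_max (Option A ⊕ Fin 511) 3 (digitNonEdge R 511)ᶜ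
  have hN : (0 : ℝ) < Fintype.card A := by exact_mod_cast Fintype.card_pos
  have hδ0 : 0 < δ := by
    by_contra! h
    nlinarith
  refine ⟨γ, ⟨_, _, _, hγ⟩, ?_, ?_⟩
  · let w : Option A ⊕ Fin 511 → ℝ := Sum.elim
      (fun o => o.elim (1 / 512 - 2 / (3 * 512 ^ 2)) fun _ => 2 / (3 * 512 ^ 2) * δ)
      fun _ => 1 / 512
    have hsum : ∑ u : A, 2 / (3 * 512 ^ 2) * δ = 2 / (3 * 512 ^ 2) := by
      rw [Finset.sum_const, nsmul_eq_mul, Finset.card_univ]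
      linear_combination 2 / (3 * 512 ^ 2) * hδ
    have hsum2 : ∑ u : A, (2 / (3 * 512 ^ 2) * δ) ^ 2 = (2 / (3 * 512 ^ 2)) ^ 2 * δ := by
      rw [Finset.sum_const, nsmul_eq_mul, Finset.card_univ]
      linear_combination (2 / (3 * 512 ^ 2)) ^ 2 * δ * hδ
    have hw : w ∈ stdSimplex ℝ (Option A ⊕ Fin 511) := by
      refine ⟨?_, ?_⟩
      · rintro ((_ | u) | i)
        · simp only [w, Sum.elim_inl, Option.elim]; norm_num
        · simp only [w, Sum.elim_inl, Option.elim]; positivity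
        · simp only [w, Sum.elim_inr]; norm_num
      · simp only [w, Fintype.sum_sum_type, Fintype.sum_option, Sum.elim_inl, Option.elim, hsum,
          Sum.elim_inr, Finset.sum_const, Finset.card_univ, Fintype.card_fin, nsmul_eq_mul]
        norm_num
    refine le_trans ?_ (hγ.2 ⟨w, hw, rfl⟩)
    have hP : (512 - ε) * (2 / (3 * 512 ^ 2)) ^ 2 * δ ≤ ∑ u : A, ∑ v,
        if R u v then (2 / (3 * 512 ^ 2) * δ) * (2 / (3 * 512 ^ 2) * δ) else 0 := by
      have : (∑ u : A, ∑ v, if R u v then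
          (2 / (3 * 512 ^ 2) * δ) * (2 / (3 * 512 ^ 2) * δ) else 0) =
          (2 / (3 * 512 ^ 2) * δ) ^ 2 * ∑ u : A, ∑ v, if R u v then (1 : ℝ) else 0 := by
        simp only [Finset.mul_sum]
        refine Finset.sum_congr rfl fun u _ => Finset.sum_congr rfl fun v _ => ?_
        split_ifs <;> ring
      rw [this]
      refine le_trans (le_of_eq ?_) (mul_le_mul_of_nonneg_left hdeg (sq_nonneg _))
      linear_combination -(512 - ε) * (2 / (3 * 512 ^ 2)) ^ 2 * δ * hδ
    rw [patPoly_digit hR, hw.2]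
    simp only [w, Fintype.sum_option, Sum.elim_inl, Option.elim, hsum, hsum2,
          Sum.elim_inr, Finset.sum_const, Finset.card_univ, Fintype.card_fin, nsmul_eq_mul]
    have := mul_nonneg hε hδ0.le
    norm_num at hP ⊢
    linarith
  · obtain ⟨w, hw, rfl⟩ := hγ.1
    have hw0 := hw.1
    have hw1 := hw.2
    rw [patPoly_digit hR, hw.2]
    rw [Fintype.sum_sum_type, Fintype.sum_option] at hw1
    rw [Fintype.sum_option, one_pow, add_comm (w (Sum.inl none))]
    refine digit_upper (Finset.sum_nonneg fun u _ => hw0 _) (hw0 _)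
      (Finset.sum_nonneg fun u _ => hw0 _) (by linarith) hδ0 hδ' ?_
      (hspec _ fun u => hw0 _) ?_ ?_
    · have := sq_sum_le_card_mul_sum_sq (s := Finset.univ) (f := fun u : A => w (Sum.inl (some u)))
      have h2 := mul_le_mul_of_nonneg_right this hδ0.le
      refine h2.trans (le_of_eq ?_)
      rw [Finset.card_univ]
      linear_combination (∑ u : A, w (Sum.inl (some u)) ^ 2) * hδ
    · rw [pow_two, Finset.sum_mul_sum, ← Finset.sum_sub_distrib]
      refine Finset.sum_le_sum fun u _ => ?_
      rw [← Finset.add_sum_erase _ _ (Finset.mem_univ u), if_neg (hirr u),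
        ← Finset.add_sum_erase Finset.univ (fun v => w (Sum.inl (some u)) * w (Sum.inl (some v)))
        (Finset.mem_univ u), zero_add, ← pow_two, add_sub_cancel_left]
      refine Finset.sum_le_sum fun v _ => ?_
      split_ifs
      · exact le_rfl
      · exact mul_nonneg (hw0 _) (hw0 _)
    · have h3 := pow_sum_div_card_le_sum_pow (s := (Finset.univ : Finset (Fin 511)))
        (f := fun i => w (Sum.inr i)) (fun i _ => hw0 _) 2
      simpa using h3

end Digit

section Torus

open ComplexConjugate

variable {n : ℕ} [NeZero n]

/-- The Fourier transform on the discrete torus. -/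
noncomputable def torusFourier (f : ZMod n × ZMod n → ℝ) (k : ZMod n × ZMod n) : ℂ :=
  ∑ u, f u * ZMod.stdAddChar (u.1 * k.1 + u.2 * k.2)

lemma sum_stdAddChar_torus (a : ZMod n × ZMod n) :
    ∑ k : ZMod n × ZMod n, ZMod.stdAddChar (k.1 * a.1 + k.2 * a.2) =
      if a = 0 then (n : ℂ) ^ 2 else 0 := by
  simp only [AddChar.map_add_eq_mul, Fintype.sum_prod_type]
  rw [← Finset.sum_mul_sum, AddChar.sum_mulShift _ (ZMod.isPrimitive_stdAddChar n),
    AddChar.sum_mulShift _ (ZMod.isPrimitive_stdAddChar n)]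
  simp only [Prod.ext_iff, Prod.fst_zero, Prod.snd_zero, ZMod.card]
  split_ifs <;> simp_all [pow_two]

lemma sum_norm_sq_torusFourier (f : ZMod n × ZMod n → ℝ) :
    ∑ k, ‖torusFourier f k‖ ^ 2 = n ^ 2 * ∑ u, f u ^ 2 := by
  have h : ∀ k, ((‖torusFourier f k‖ ^ 2 : ℝ) : ℂ) = ∑ u, ∑ v, (f u * f v : ℂ) *
      ZMod.stdAddChar (k.1 * (u - v).1 + k.2 * (u - v).2) := by
    intro k
    rw [Complex.ofReal_pow, ← Complex.mul_conj', torusFourier, map_sum, Finset.sum_mul_sum]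
    refine Finset.sum_congr rfl fun u _ => Finset.sum_congr rfl fun v _ => ?_
    rw [map_mul, Complex.conj_ofReal, ← AddChar.map_neg_eq_conj, mul_mul_mul_comm,
      ← AddChar.map_add_eq_mul]
    congr 2
    simp only [Prod.fst_sub, Prod.snd_sub]
    ring
  have : ((∑ k, ‖torusFourier f k‖ ^ 2 : ℝ) : ℂ) = ((n ^ 2 * ∑ u, f u ^ 2 : ℝ) : ℂ) := by
    rw [Complex.ofReal_sum]
    simp only [h]
    rw [Finset.sum_comm]
    push_cast
    rw [Finset.mul_sum]
    refine Finset.sum_congr rfl fun u _ => ?_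
    rw [Finset.sum_comm]
    simp only [← Finset.mul_sum, sum_stdAddChar_torus, sub_eq_zero]
    simp [pow_two, mul_comm]
  exact_mod_cast this

lemma torusFourier_sub (f g : ZMod n × ZMod n → ℝ) (k : ZMod n × ZMod n) :
    torusFourier (fun u => f u - g u) k = torusFourier f k - torusFourier g k := by
  simp only [torusFourier, ← Finset.sum_sub_distrib]
  refine Finset.sum_congr rfl fun u _ => ?_
  push_cast
  ring

/-- A shear of the torus. -/
def shearFst : ZMod n × ZMod n ≃ ZMod n × ZMod n where
  toFun u := (u.1 + u.2, u.2)
  invFun u := (u.1 - u.2, u.2)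
  left_inv u := by simp
  right_inv u := by simp

/-- A shear of the torus. -/
def shearSnd : ZMod n × ZMod n ≃ ZMod n × ZMod n where
  toFun u := (u.1, u.2 + u.1)
  invFun u := (u.1, u.2 - u.1)
  left_inv u := by simp
  right_inv u := by simp

lemma torusFourier_translate (f : ZMod n × ZMod n → ℝ) (a k : ZMod n × ZMod n) :
    torusFourier (fun u => f (u + a)) k =
      ZMod.stdAddChar (-(a.1 * k.1 + a.2 * k.2)) * torusFourier f k := by
  rw [torusFourier, torusFourier, ← Equiv.sum_comp (Equiv.addRight a)
    (fun u => (f u : ℂ) * ZMod.stdAddChar (u.1 * k.1 + u.2 * k.2)), Finset.mul_sum]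
  refine Finset.sum_congr rfl fun u _ => ?_
  rw [Equiv.coe_addRight, mul_left_comm, ← AddChar.map_add_eq_mul]
  congr 2
  simp only [Prod.fst_add, Prod.snd_add]
  ring

lemma torusFourier_shearFst (f : ZMod n × ZMod n → ℝ) (k : ZMod n × ZMod n) :
    torusFourier (fun u => f (shearFst u)) k = torusFourier f (shearSnd.symm k) := by
  rw [torusFourier, torusFourier, ← Equiv.sum_comp shearFst
    (fun u => (f u : ℂ) * ZMod.stdAddChar (u.1 * (shearSnd.symm k).1 + u.2 * (shearSnd.symm k).2))]
  refine Finset.sum_congr rfl fun u _ => ?_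
  congr 2
  simp only [shearFst, shearSnd, Equiv.coe_fn_mk, Equiv.coe_fn_symm_mk]
  ring

lemma torusFourier_shearSnd (f : ZMod n × ZMod n → ℝ) (k : ZMod n × ZMod n) :
    torusFourier (fun u => f (shearSnd u)) k = torusFourier f (shearFst.symm k) := by
  rw [torusFourier, torusFourier, ← Equiv.sum_comp shearSnd
    (fun u => (f u : ℂ) * ZMod.stdAddChar (u.1 * (shearFst.symm k).1 + u.2 * (shearFst.symm k).2))]
  refine Finset.sum_congr rfl fun u _ => ?_
  congr 2
  simp only [shearFst, shearSnd, Equiv.coe_fn_mk, Equiv.coe_fn_symm_mk]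
  ring

lemma sum_norm_sub_sq (f g : ZMod n × ZMod n → ℝ) :
    ∑ k, ‖torusFourier f k - torusFourier g k‖ ^ 2 = n ^ 2 * ∑ u, (f u - g u) ^ 2 := by
  simp only [← torusFourier_sub, sum_norm_sq_torusFourier]

lemma two_le_norm_one_sub_stdAddChar_sq {x : ZMod n} (hx : (n : ℤ) ≤ 4 * |x.valMinAbs|) :
    2 ≤ ‖1 - ZMod.stdAddChar (-x)‖ ^ 2 := by
  have hn : (0 : ℝ) < n := by exact_mod_cast Nat.pos_of_ne_zero (NeZero.ne n)
  have h1 : (ZMod.stdAddChar (-x)).re = Real.cos (2 * Real.pi * x.valMinAbs / n) := by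
    rw [AddChar.map_neg_eq_conj, Complex.conj_re]
    conv_lhs => rw [← ZMod.coe_valMinAbs x, ZMod.stdAddChar_coe]
    rw [← Complex.exp_ofReal_mul_I_re]
    congr 2
    push_cast
    ring
  have h2 : Real.cos (2 * Real.pi * x.valMinAbs / n) ≤ 0 := by
    have hle : 2 * |x.valMinAbs| ≤ n := by
      have := x.valMinAbs_mem_Ioc
      rw [Set.mem_Ioc] at this
      rcases abs_cases x.valMinAbs with h | h <;> omega
    rw [← Real.cos_abs, abs_div, abs_mul, abs_of_pos Real.two_pi_pos, abs_of_pos hn]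
    have e1 : (n : ℝ) ≤ 4 * |(x.valMinAbs : ℝ)| := by exact_mod_cast hx
    have e2 : 2 * |(x.valMinAbs : ℝ)| ≤ n := by exact_mod_cast hle
    apply Real.cos_nonpos_of_pi_div_two_le_of_le
    · rw [le_div_iff₀ hn]
      nlinarith [Real.pi_pos]
    · rw [div_le_iff₀ hn]
      nlinarith [Real.pi_pos]
  have h3 : ‖ZMod.stdAddChar (-x)‖ = 1 := AddChar.norm_apply _ _
  rw [← Complex.normSq_eq_norm_sq, Complex.normSq_sub, Complex.normSq_one,
    Complex.normSq_eq_norm_sq, h3, one_mul, Complex.conj_re, h1]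
  linarith

end Torus

section Gap

lemma sum_norm_sq_sub_le {X : Type} [Fintype X] (σ : X ≃ X) (F : X → ℂ) (B : Finset X) :
    ∑ k ∈ B, ‖F k‖ ^ 2 - ∑ k ∈ B, ‖F (σ k)‖ ^ 2 ≤
      8 * ∑ k, ‖F k - F (σ k)‖ ^ 2 + (∑ k, ‖F k‖ ^ 2) / 8 := by
  have h1 : ∀ k, ‖F k‖ ^ 2 - ‖F (σ k)‖ ^ 2 ≤
      8 * ‖F k - F (σ k)‖ ^ 2 + (‖F k‖ ^ 2 / 16 + ‖F (σ k)‖ ^ 2 / 16) := by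
    intro k
    have e1 : ‖F k‖ - ‖F (σ k)‖ ≤ ‖F k - F (σ k)‖ := norm_sub_norm_le _ _
    have e2 := mul_le_mul_of_nonneg_right e1
      (add_nonneg (norm_nonneg (F k)) (norm_nonneg (F (σ k))))
    nlinarith [sq_nonneg (16 * ‖F k - F (σ k)‖ - (‖F k‖ + ‖F (σ k)‖)),
      sq_nonneg (‖F k‖ - ‖F (σ k)‖)]
  calc ∑ k ∈ B, ‖F k‖ ^ 2 - ∑ k ∈ B, ‖F (σ k)‖ ^ 2
      ≤ ∑ k ∈ B, (8 * ‖F k - F (σ k)‖ ^ 2 + (‖F k‖ ^ 2 / 16 + ‖F (σ k)‖ ^ 2 / 16)) := by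
        rw [← Finset.sum_sub_distrib]
        exact Finset.sum_le_sum fun k _ => h1 k
    _ ≤ ∑ k, (8 * ‖F k - F (σ k)‖ ^ 2 + (‖F k‖ ^ 2 / 16 + ‖F (σ k)‖ ^ 2 / 16)) :=
        Finset.sum_le_sum_of_subset_of_nonneg (Finset.subset_univ B) fun k _ _ => by positivity
    _ = _ := by
        rw [Finset.sum_add_distrib, Finset.sum_add_distrib, ← Finset.mul_sum, ← Finset.sum_div,
          ← Finset.sum_div, Equiv.sum_comp σ (fun k => ‖F k‖ ^ 2)]
        ring

variable {n : ℕ} [NeZero n]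

/-- Both coordinates have small representatives. -/
def TorusSmall (k : ZMod n × ZMod n) : Prop :=
  4 * |k.1.valMinAbs| < n ∧ 4 * |k.2.valMinAbs| < n

/-- The open second and fourth quadrants, together with the vertical axis. -/
def TorusCone (k : ZMod n × ZMod n) : Prop :=
  (k.1.valMinAbs ≤ 0 ∧ 0 < k.2.valMinAbs) ∨ (0 ≤ k.1.valMinAbs ∧ k.2.valMinAbs < 0)

lemma valMinAbs_sub_of_small {x y : ZMod n} (hx : 4 * |x.valMinAbs| < n)
    (hy : 4 * |y.valMinAbs| < n) : (x - y).valMinAbs = x.valMinAbs - y.valMinAbs := by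
  rw [ZMod.valMinAbs_spec]
  refine ⟨by simp, ?_⟩
  rw [Set.mem_Ioc]
  rcases abs_cases x.valMinAbs with h | h <;> rcases abs_cases y.valMinAbs with h' | h' <;> omega

open Classical in
lemma sum_torusCone_le (F : ZMod n × ZMod n → ℂ) :
    ∑ k with TorusCone k ∧ TorusSmall k, ‖F k‖ ^ 2 ≤ ∑ k with ¬ TorusSmall k, ‖F k‖ ^ 2 +
      8 * (∑ k, ‖F k - F (shearSnd.symm k)‖ ^ 2 + ∑ k, ‖F k - F (shearFst.symm k)‖ ^ 2) +
      (∑ k, ‖F k‖ ^ 2) / 4 := by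
  set B : Finset (ZMod n × ZMod n) := {k | TorusCone k ∧ TorusSmall k} with hB
  set T : Finset (ZMod n × ZMod n) := {k | ¬ TorusSmall k} with hT
  have h1 := sum_norm_sq_sub_le shearSnd.symm F B
  have h2 := sum_norm_sq_sub_le shearFst.symm F B
  have hS : ∀ k ∈ B, TorusCone (shearSnd.symm k) ∧
      |(shearSnd.symm k).1.valMinAbs| < |(shearSnd.symm k).2.valMinAbs| := by
    intro k hk
    obtain ⟨hc, hs⟩ := (Finset.mem_filter.1 hk).2
    have := valMinAbs_sub_of_small hs.2 hs.1
    simp only [TorusCone, shearSnd, Equiv.coe_fn_symm_mk, this] at hc ⊢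
    grind
  have hT' : ∀ k ∈ B, TorusCone (shearFst.symm k) ∧
      |(shearFst.symm k).2.valMinAbs| ≤ |(shearFst.symm k).1.valMinAbs| := by
    intro k hk
    obtain ⟨hc, hs⟩ := (Finset.mem_filter.1 hk).2
    have := valMinAbs_sub_of_small hs.1 hs.2
    simp only [TorusCone, shearFst, Equiv.coe_fn_symm_mk, this] at hc ⊢
    grind
  have hdisj : Disjoint (B.map shearSnd.symm.toEmbedding) (B.map shearFst.symm.toEmbedding) := by
    rw [Finset.disjoint_left]
    intro k hk hk'
    obtain ⟨u, hu, rfl⟩ := Finset.mem_map.1 hk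
    obtain ⟨v, hv, h⟩ := Finset.mem_map.1 hk'
    have e1 := (hS u hu).2
    have e2 := (hT' v hv).2
    simp only [Equiv.coe_toEmbedding] at h
    rw [h] at e2
    exact absurd e1 (not_lt.2 e2)
  have hsub : B.map shearSnd.symm.toEmbedding ∪ B.map shearFst.symm.toEmbedding ⊆ B ∪ T := by
    intro k hk
    have hc : TorusCone k := by
      rcases Finset.mem_union.1 hk with h | h <;> obtain ⟨u, hu, rfl⟩ := Finset.mem_map.1 h
      · exact (hS u hu).1
      · exact (hT' u hu).1
    simp only [hB, hT, Finset.mem_union, Finset.mem_filter, Finset.mem_univ, true_and]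
    tauto
  have h3 : ∑ k ∈ B, ‖F (shearSnd.symm k)‖ ^ 2 + ∑ k ∈ B, ‖F (shearFst.symm k)‖ ^ 2 ≤
      ∑ k ∈ B, ‖F k‖ ^ 2 + ∑ k ∈ T, ‖F k‖ ^ 2 := by
    have e1 := Finset.sum_le_sum_of_subset_of_nonneg hsub (f := fun k => ‖F k‖ ^ 2)
      fun k _ _ => by positivity
    rw [Finset.sum_union hdisj, Finset.sum_map, Finset.sum_map] at e1
    refine e1.trans ?_
    rw [← Finset.sum_union_inter]
    exact le_add_of_nonneg_right (Finset.sum_nonneg fun k _ => by positivity)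
  linarith

/-- The rotation by a right angle. -/
def torusRotate : ZMod n × ZMod n ≃ ZMod n × ZMod n where
  toFun k := (-k.2, k.1)
  invFun k := (k.2, -k.1)
  left_inv k := by simp
  right_inv k := by simp

lemma sum_norm_sub_symm {X : Type} [Fintype X] (σ : X ≃ X) (F : X → ℂ) :
    ∑ k, ‖F k - F (σ k)‖ ^ 2 = ∑ k, ‖F k - F (σ.symm k)‖ ^ 2 := by
  rw [← Equiv.sum_comp σ (fun k => ‖F k - F (σ.symm k)‖ ^ 2)]
  simp only [Equiv.symm_apply_apply, norm_sub_rev]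

open Classical in
lemma sum_norm_sq_le_of_zero {F : ZMod n × ZMod n → ℂ} (h0 : F 0 = 0) :
    ∑ k, ‖F k‖ ^ 2 ≤ 6 * ∑ k with ¬ TorusSmall k, ‖F k‖ ^ 2 +
      32 * (∑ k, ‖F k - F (shearSnd.symm k)‖ ^ 2 + ∑ k, ‖F k - F (shearFst.symm k)‖ ^ 2) := by
  have h1 := sum_torusCone_le F
  have h2 := sum_torusCone_le (F ∘ torusRotate)
  have hs : ∀ k : ZMod n × ZMod n, TorusSmall (torusRotate k) ↔ TorusSmall k := by
    intro k
    simp only [TorusSmall, torusRotate, Equiv.coe_fn_mk]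
    rw [Int.abs_eq_natAbs (-k.2).valMinAbs, ZMod.natAbs_valMinAbs_neg, ← Int.abs_eq_natAbs]
    tauto
  have hV : ∑ k, ‖(F ∘ torusRotate) k‖ ^ 2 = ∑ k, ‖F k‖ ^ 2 :=
    Equiv.sum_comp torusRotate (fun k => ‖F k‖ ^ 2)
  have hT : ∑ k with ¬ TorusSmall k, ‖(F ∘ torusRotate) k‖ ^ 2 =
      ∑ k with ¬ TorusSmall k, ‖F k‖ ^ 2 := by
    rw [Finset.sum_filter, Finset.sum_filter,
      ← Equiv.sum_comp torusRotate (fun k => if ¬ TorusSmall k then ‖F k‖ ^ 2 else 0)]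
    simp only [hs, Function.comp_apply]
  have hD1 : ∑ k, ‖(F ∘ torusRotate) k - (F ∘ torusRotate) (shearSnd.symm k)‖ ^ 2 =
      ∑ k, ‖F k - F (shearFst.symm k)‖ ^ 2 := by
    rw [← sum_norm_sub_symm shearFst F,
      ← Equiv.sum_comp torusRotate (fun k => ‖F k - F (shearFst k)‖ ^ 2)]
    refine Finset.sum_congr rfl fun k _ => ?_
    have : torusRotate (shearSnd.symm k) = shearFst (torusRotate k) := by
      simp [torusRotate, shearSnd, shearFst, sub_eq_neg_add, add_comm]
    simp only [Function.comp_apply, this]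
  have hD2 : ∑ k, ‖(F ∘ torusRotate) k - (F ∘ torusRotate) (shearFst.symm k)‖ ^ 2 =
      ∑ k, ‖F k - F (shearSnd.symm k)‖ ^ 2 := by
    rw [← sum_norm_sub_symm shearSnd F,
      ← Equiv.sum_comp torusRotate (fun k => ‖F k - F (shearSnd k)‖ ^ 2)]
    refine Finset.sum_congr rfl fun k _ => ?_
    have : torusRotate (shearFst.symm k) = shearSnd (torusRotate k) := by
      simp [torusRotate, shearSnd, shearFst, sub_eq_add_neg]
    simp only [Function.comp_apply, this]
  rw [hV, hT, hD1, hD2] at h2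
  have h3 : ∑ k, ‖F k‖ ^ 2 ≤ ∑ k with TorusCone k ∧ TorusSmall k, ‖F k‖ ^ 2 +
      ∑ k with TorusCone k ∧ TorusSmall k, ‖(F ∘ torusRotate) k‖ ^ 2 +
      ∑ k with ¬ TorusSmall k, ‖F k‖ ^ 2 := by
    have e1 : ∑ k with TorusCone k ∧ TorusSmall k, ‖(F ∘ torusRotate) k‖ ^ 2 =
        ∑ k with TorusCone (torusRotate.symm k) ∧ TorusSmall k, ‖F k‖ ^ 2 := by
      rw [Finset.sum_filter, Finset.sum_filter, ← Equiv.sum_comp torusRotate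
        (fun k => if TorusCone (torusRotate.symm k) ∧ TorusSmall k then ‖F k‖ ^ 2 else 0)]
      simp only [hs, Function.comp_apply, Equiv.symm_apply_apply]
    rw [e1, Finset.sum_filter, Finset.sum_filter, Finset.sum_filter, ← Finset.sum_add_distrib,
      ← Finset.sum_add_distrib]
    refine Finset.sum_le_sum fun k _ => ?_
    by_cases hk0 : k = 0
    · rw [hk0, h0]
      simp
    by_cases hks : TorusSmall k
    · have hc : TorusCone k ∨ TorusCone (torusRotate.symm k) := by
        have e2 : (-k.1).valMinAbs = -k.1.valMinAbs := by
          have := valMinAbs_sub_of_small (x := 0) (y := k.1)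
            (by simpa using Nat.pos_of_ne_zero (NeZero.ne n)) hks.1
          simpa using this
        have e3 : k.1.valMinAbs ≠ 0 ∨ k.2.valMinAbs ≠ 0 := by
          by_contra! h
          exact hk0 (Prod.ext ((ZMod.valMinAbs_eq_zero _).1 h.1) ((ZMod.valMinAbs_eq_zero _).1 h.2))
        simp only [TorusCone, torusRotate, Equiv.coe_fn_symm_mk, e2]
        omega
      have := sq_nonneg ‖F k‖
      rcases hc with hc | hc
      · simp only [hc, hks, and_self, if_true, not_true, if_false]
        split_ifs <;> linarith
      · simp only [hc, hks, and_self, if_true, not_true, if_false]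
        split_ifs <;> linarith
    · simp [hks]
  linarith

/-- The generators of the expanding action on the torus. -/
def torusGen : Fin 4 → (ZMod n × ZMod n ≃ ZMod n × ZMod n) :=
  ![Equiv.addRight (1, 0), Equiv.addRight (0, 1), shearFst, shearSnd]

lemma sum_sq_le_of_sum_eq_zero {f : ZMod n × ZMod n → ℝ} (h0 : ∑ u, f u = 0) :
    ∑ u, f u ^ 2 ≤ 32 * ∑ g, ∑ u, (f u - f (torusGen g u)) ^ 2 := by
  classical
  have hF0 : torusFourier f 0 = 0 := by
    simp only [torusFourier, Prod.fst_zero, Prod.snd_zero, mul_zero, add_zero,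
      AddChar.map_zero_eq_one, mul_one]
    exact_mod_cast h0
  have h := sum_norm_sq_le_of_zero hF0
  simp only [← torusFourier_shearFst, ← torusFourier_shearSnd, sum_norm_sub_sq,
    sum_norm_sq_torusFourier] at h
  have ht : ∀ a : ZMod n × ZMod n, ∑ k : ZMod n × ZMod n,
      ‖1 - ZMod.stdAddChar (-(a.1 * k.1 + a.2 * k.2))‖ ^ 2 * ‖torusFourier f k‖ ^ 2 =
      n ^ 2 * ∑ u, (f u - f (u + a)) ^ 2 := by
    intro a
    rw [← sum_norm_sub_sq]
    refine Finset.sum_congr rfl fun k _ => ?_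
    rw [torusFourier_translate, ← mul_pow, ← norm_mul, sub_mul, one_mul]
  have hsmall : 2 * ∑ k with ¬ TorusSmall k, ‖torusFourier f k‖ ^ 2 ≤
      n ^ 2 * ∑ u, (f u - f (u + (1, 0))) ^ 2 + n ^ 2 * ∑ u, (f u - f (u + (0, 1))) ^ 2 := by
    rw [← ht, ← ht, Finset.sum_filter, Finset.mul_sum, ← Finset.sum_add_distrib]
    refine Finset.sum_le_sum fun k _ => ?_
    simp only [one_mul, zero_mul, add_zero, zero_add]
    split_ifs with hk
    · rw [mul_zero]
      positivity
    · have hk' : (n : ℤ) ≤ 4 * |k.1.valMinAbs| ∨ (n : ℤ) ≤ 4 * |k.2.valMinAbs| := by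
        by_contra! hc
        exact hk hc
      rw [← add_mul]
      refine mul_le_mul_of_nonneg_right ?_ (sq_nonneg _)
      rcases hk' with hk' | hk'
      · linarith [two_le_norm_one_sub_stdAddChar_sq hk',
          sq_nonneg ‖1 - ZMod.stdAddChar (-k.2)‖]
      · linarith [two_le_norm_one_sub_stdAddChar_sq hk',
          sq_nonneg ‖1 - ZMod.stdAddChar (-k.1)‖]
  have hn : (0 : ℝ) < n ^ 2 := by
    have : (0 : ℝ) < n := by exact_mod_cast Nat.pos_of_ne_zero (NeZero.ne n)
    positivity
  refine le_of_mul_le_mul_left (a := (n : ℝ) ^ 2) ?_ hn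
  simp only [Fin.sum_univ_four, torusGen, Matrix.cons_val, Equiv.coe_addRight]
  have e1 : 0 ≤ ∑ u, (f u - f (u + (1, 0))) ^ 2 := Finset.sum_nonneg fun u _ => sq_nonneg _
  have e2 : 0 ≤ ∑ u, (f u - f (u + (0, 1))) ^ 2 := Finset.sum_nonneg fun u _ => sq_nonneg _
  have e3 := mul_nonneg hn.le e1
  have e4 := mul_nonneg hn.le e2
  linarith

lemma sum_mul_torusGen_le (f : ZMod n × ZMod n → ℝ) :
    ∑ g, 2 * ∑ u, f u * f (torusGen g u) ≤
      (8 - 1 / 32) * ∑ u, f u ^ 2 + 1 / 32 * ((∑ u, f u) ^ 2 / n ^ 2) := by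
  have hn : (0 : ℝ) < n := by exact_mod_cast Nat.pos_of_ne_zero (NeZero.ne n)
  have hc : ∑ _u : ZMod n × ZMod n, (1 : ℝ) = n ^ 2 := by
    simp [pow_two]
  set μ := (∑ u, f u) / n ^ 2 with hμ
  have hμ' : ∑ u, f u = μ * n ^ 2 := by rw [hμ]; field_simp
  have hc' : ∀ c : ℝ, ∑ _u : ZMod n × ZMod n, c = c * n ^ 2 := by
    intro c
    rw [← hc, Finset.mul_sum, mul_one]
  have h := sum_sq_le_of_sum_eq_zero (f := fun u => f u - μ)
    (by rw [Finset.sum_sub_distrib, hc', hμ', sub_self])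
  have h1 : ∑ u, (f u - μ) ^ 2 = ∑ u, f u ^ 2 - (∑ u, f u) ^ 2 / n ^ 2 := by
    simp only [sub_sq, Finset.sum_add_distrib, Finset.sum_sub_distrib, ← Finset.sum_mul,
      ← Finset.mul_sum, hc', hμ']
    field_simp
    ring
  have h2 : ∀ g : Fin 4, ∑ u, (f u - μ - (f (torusGen g u) - μ)) ^ 2 =
      2 * ∑ u, f u ^ 2 - 2 * ∑ u, f u * f (torusGen g u) := by
    intro g
    simp only [sub_sub_sub_cancel_right, sub_sq, Finset.sum_add_distrib, Finset.sum_sub_distrib]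
    rw [Equiv.sum_comp (torusGen g) (fun u => f u ^ 2)]
    simp only [mul_assoc, ← Finset.mul_sum]
    ring
  simp only [h1, h2, Finset.sum_sub_distrib, Finset.sum_const, Finset.card_univ, Fintype.card_fin,
    nsmul_eq_mul] at h
  push_cast at h
  linarith

end Gap

section Expander

variable {n : ℕ}

/-- Distinct points of the torus related by one of the generators. -/
def TorusAdj (u v : ZMod n × ZMod n) : Prop := u ≠ v ∧ ∃ g, v = torusGen g u ∨ u = torusGen g v

lemma TorusAdj.symm {u v : ZMod n × ZMod n} (h : TorusAdj u v) : TorusAdj v u :=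
  ⟨h.1.symm, h.2.imp fun _ => Or.symm⟩

open Classical in
lemma sum_torusAdj_le [NeZero n] {f : ZMod n × ZMod n → ℝ} (hf : ∀ u, 0 ≤ f u) :
    (∑ u, ∑ v, if TorusAdj u v then f u * f v else 0) ≤
      (8 - 1 / 32) * ∑ u, f u ^ 2 + 1 / 32 * ((∑ u, f u) ^ 2 / n ^ 2) := by
  refine le_trans ?_ (sum_mul_torusGen_le f)
  have h : ∀ u v, (if TorusAdj u v then f u * f v else 0) ≤
      ∑ g, ((if v = torusGen g u then f u * f v else 0) +
        if u = torusGen g v then f v * f u else 0) := by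
    intro u v
    have h0 : 0 ≤ f u * f v := mul_nonneg (hf u) (hf v)
    have h1 : ∀ g : Fin 4, 0 ≤ (if v = torusGen g u then f u * f v else 0) +
        if u = torusGen g v then f v * f u else 0 := by
      intro g
      rw [mul_comm (f v)]
      split_ifs <;> linarith
    split_ifs with hadj
    · obtain ⟨-, g, hg⟩ := hadj
      refine le_trans ?_ (Finset.single_le_sum (fun g _ => h1 g) (Finset.mem_univ g))
      rw [mul_comm (f v)]
      rcases hg with hg | hg
      · rw [if_pos hg]
        split_ifs <;> linarith
      · rw [if_pos hg]
        split_ifs <;> linarith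
    · exact Finset.sum_nonneg fun g _ => h1 g
  refine (Finset.sum_le_sum fun u _ => Finset.sum_le_sum fun v _ => h u v).trans (le_of_eq ?_)
  calc _ = ∑ g, ∑ u, ∑ v, ((if v = torusGen g u then f u * f v else 0) +
        if u = torusGen g v then f v * f u else 0) := by
        rw [Finset.sum_congr rfl fun u _ => Finset.sum_comm]
        exact Finset.sum_comm
    _ = _ := by
        refine Finset.sum_congr rfl fun g _ => ?_
        simp only [Finset.sum_add_distrib]
        rw [Finset.sum_comm (f := fun u v => if u = torusGen g v then f v * f u else 0)]
        simp only [Finset.sum_ite_eq', Finset.mem_univ, if_true]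
        ring

lemma eight_le_card_torusAdj [NeZero n] (hn : Odd n) (hn3 : 3 ≤ n) {x y : ZMod n}
    (hx : x ∉ ({0, 1, -1} : Finset (ZMod n))) (hy : y ∉ ({0, 1, -1} : Finset (ZMod n)))
    [DecidablePred (TorusAdj (x, y))] :
    8 ≤ (Finset.univ.filter (TorusAdj (x, y))).card := by
  have : Fact (1 < n) := ⟨by omega⟩
  have hneg : ∀ a : ZMod n, a ≠ 0 → a ≠ -a := fun a ha => ZMod.ne_neg_self hn ha
  have h1 : (1 : ZMod n) ≠ -1 := hneg 1 one_ne_zero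
  have hcard : ∀ a : ZMod n, a ∉ ({0, 1, -1} : Finset (ZMod n)) →
      ({1, -1, a, -a} : Finset (ZMod n)).card = 4 ∧
        (0 : ZMod n) ∉ ({1, -1, a, -a} : Finset (ZMod n)) := by
    intro a ha
    simp only [Finset.mem_insert, Finset.mem_singleton, not_or] at ha
    obtain ⟨ha0, ha1, ha2⟩ := ha
    have e1 := hneg a ha0
    have e2 : (1 : ZMod n) ≠ -a := fun h => ha2 (by rw [h, neg_neg])
    constructor
    · rw [Finset.card_insert_of_notMem, Finset.card_insert_of_notMem,
        Finset.card_insert_of_notMem, Finset.card_singleton]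
      · simpa using e1
      · simp only [Finset.mem_insert, Finset.mem_singleton, not_or]
        exact ⟨fun h => ha2 h.symm, fun h => ha1 (neg_injective h).symm⟩
      · simp only [Finset.mem_insert, Finset.mem_singleton, not_or]
        exact ⟨h1, fun h => ha1 h.symm, e2⟩
    · simp [ha0, eq_comm]
  obtain ⟨hx4, hx0⟩ := hcard x hx
  obtain ⟨hy4, hy0⟩ := hcard y hy
  set S₁ := ({1, -1, y, -y} : Finset (ZMod n)).image fun t => (x + t, y) with hS₁
  set S₂ := ({1, -1, x, -x} : Finset (ZMod n)).image fun t => (x, y + t) with hS₂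
  have c1 : S₁.card = 4 := by
    rw [hS₁, Finset.card_image_of_injective _ (fun a b h => by simpa using h), hy4]
  have c2 : S₂.card = 4 := by
    rw [hS₂, Finset.card_image_of_injective _ (fun a b h => by simpa using h), hx4]
  have hd : Disjoint S₁ S₂ := by
    rw [Finset.disjoint_left]
    intro u hu hu'
    obtain ⟨t, ht, rfl⟩ := Finset.mem_image.1 hu
    obtain ⟨s, hs, h⟩ := Finset.mem_image.1 hu'
    have : t = 0 := by simpa using (congrArg Prod.fst h).symm
    exact hy0 (this ▸ ht)
  have hsub : S₁ ∪ S₂ ⊆ Finset.univ.filter (TorusAdj (x, y)) := by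
    intro u hu
    refine Finset.mem_filter.2 ⟨Finset.mem_univ _, ?_⟩
    rcases Finset.mem_union.1 hu with h | h <;> obtain ⟨t, ht, rfl⟩ := Finset.mem_image.1 h
    · refine ⟨fun h => hy0 ?_, ?_⟩
      · have : t = 0 := by simpa using (congrArg Prod.fst h).symm
        exact this ▸ ht
      · simp only [Finset.mem_insert, Finset.mem_singleton] at ht
        rcases ht with rfl | rfl | rfl | rfl
        · exact ⟨0, by simp [torusGen]⟩
        · exact ⟨0, by simp [torusGen]⟩
        · exact ⟨2, by simp [torusGen, shearFst]⟩
        · exact ⟨2, by simp [torusGen, shearFst]⟩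
    · refine ⟨fun h => hx0 ?_, ?_⟩
      · have : t = 0 := by simpa using (congrArg Prod.snd h).symm
        exact this ▸ ht
      · simp only [Finset.mem_insert, Finset.mem_singleton] at ht
        rcases ht with rfl | rfl | rfl | rfl
        · exact ⟨1, by simp [torusGen]⟩
        · exact ⟨1, by simp [torusGen]⟩
        · exact ⟨3, by simp [torusGen, shearSnd]⟩
        · exact ⟨3, by simp [torusGen, shearSnd]⟩
  have := Finset.card_le_card hsub
  rwa [Finset.card_union_of_disjoint hd, c1, c2] at this

open Classical in
lemma sum_torusAdj_ge [NeZero n] (hn : Odd n) (hn3 : 3 ≤ n) :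
    (8 - 48 / (n : ℝ)) * n ^ 2 ≤
      ∑ u : ZMod n × ZMod n, ∑ v, if TorusAdj u v then (1 : ℝ) else 0 := by
  set S : Finset (ZMod n) := {0, 1, -1}ᶜ with hS
  have hc : (n : ℝ) - 3 ≤ S.card := by
    have h1 : ({0, 1, -1} : Finset (ZMod n)).card ≤ 3 := Finset.card_le_three
    have h2 := Finset.card_compl_add_card ({0, 1, -1} : Finset (ZMod n))
    rw [ZMod.card, ← hS] at h2
    have : n ≤ S.card + 3 := by omega
    have : (n : ℝ) ≤ S.card + 3 := by exact_mod_cast this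
    linarith
  have hn' : (3 : ℝ) ≤ n := by exact_mod_cast hn3
  calc (8 - 48 / (n : ℝ)) * n ^ 2 ≤ 8 * ((n : ℝ) - 3) ^ 2 := by
        have : (8 - 48 / (n : ℝ)) * n ^ 2 = 8 * n ^ 2 - 48 * n := by field_simp
        rw [this]
        linarith
    _ ≤ 8 * (S.card : ℝ) ^ 2 := by
        have := pow_le_pow_left₀ (sub_nonneg.2 hn') hc 2
        linarith
    _ = ∑ u ∈ S ×ˢ S, (8 : ℝ) := by
        rw [Finset.sum_const, Finset.card_product, nsmul_eq_mul]
        push_cast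
        ring
    _ ≤ ∑ u ∈ S ×ˢ S, ∑ v, if TorusAdj u v then (1 : ℝ) else 0 := by
        refine Finset.sum_le_sum fun u hu => ?_
        rw [Finset.mem_product] at hu
        rw [Finset.sum_boole]
        exact_mod_cast eight_le_card_torusAdj hn hn3 (Finset.mem_compl.1 hu.1)
          (Finset.mem_compl.1 hu.2)
    _ ≤ _ := Finset.sum_le_sum_of_subset_of_nonneg (Finset.subset_univ _) fun u _ _ =>
        Finset.sum_nonneg fun v _ => by split_ifs <;> norm_num

end Expander

section DigitSequence

lemma isLag_digit_base : IsLag 3 (1 - 1 / 512 ^ 2) := by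
  refine ⟨Option Empty ⊕ Fin 511, inferInstance, (digitNonEdge (fun _ _ : Empty => False) 511)ᶜ,
    ⟨fun _ => 1 / 512, ⟨fun _ => by positivity, ?_⟩, ?_⟩, ?_⟩
  · rw [Finset.sum_const, Finset.card_univ]
    simp
  · rw [patPoly_digit (fun _ _ h => h)]
    simp
    norm_num
  · rintro _ ⟨w, hw, rfl⟩
    have hw0 := hw.1
    have hw1 := hw.2
    rw [patPoly_digit (fun _ _ h => h), hw.2]
    rw [Fintype.sum_sum_type, Fintype.sum_option, Finset.univ_eq_empty, Finset.sum_empty,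
      add_zero] at hw1
    simp only [Fintype.sum_option, Finset.univ_eq_empty, Finset.sum_empty, add_zero, mul_zero,
      sub_zero, one_pow]
    have h1 := pow_sum_div_card_le_sum_pow (s := (Finset.univ : Finset (Fin 511)))
      (f := fun i => w (Sum.inr i)) (fun i _ => hw0 _) 2
    simp only [Finset.card_univ, Fintype.card_fin, Nat.cast_ofNat] at h1
    have h2 := digit_base_le (x := w (Sum.inl none)) (eq_sub_of_add_eq' hw1)
    have h3 := hw0 (Sum.inl none)
    have h4 := mul_nonneg (sq_nonneg (w (Sum.inl none) - 1 / 512)) h3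
    have h5 := sq_nonneg (w (Sum.inl none) - 1 / 512)
    norm_num at h1 h2 h4 h5 ⊢
    nlinarith

lemma exists_digit_of_odd {n : ℕ} (hn : Odd n) (hn7 : 10 ^ 7 ≤ n) :
    ∃ γ, IsLag 3 γ ∧ 4 / (9 * 512 ^ 5) - 9216 / (n : ℝ) ≤
        (γ - (1 - 1 / 512 ^ 2)) * (64 * n ^ 2) ∧
      (γ - (1 - 1 / 512 ^ 2)) * (64 * n ^ 2) ≤
        4 / (9 * 512 ^ 5) + 3 * 10 ^ 7 * (1 / (64 * (n : ℝ) ^ 2)) := by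
  classical
  have : NeZero n := ⟨by omega⟩
  have hn7' : (10 : ℝ) ^ 7 ≤ n := by exact_mod_cast hn7
  have hn0 : (0 : ℝ) < n := by linarith
  have hcard : (Fintype.card ((ZMod n × ZMod n) × Fin 64) : ℝ) = 64 * n ^ 2 := by
    simp only [Fintype.card_prod, ZMod.card, Fintype.card_fin]
    push_cast
    ring
  have hlift : ∀ F : (ZMod n × ZMod n) → (ZMod n × ZMod n) → Prop,
      ∀ m : (ZMod n × ZMod n) × Fin 64 → ℝ,
      (∑ a, ∑ b, if F a.1 b.1 then m a * m b else 0) =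
        ∑ u, ∑ v, if F u v then (∑ p, m (u, p)) * ∑ p, m (v, p) else 0 := by
    intro F m
    rw [Fintype.sum_prod_type]
    refine Finset.sum_congr rfl fun u _ => ?_
    rw [Finset.sum_congr rfl fun p _ => Fintype.sum_prod_type _, Finset.sum_comm]
    refine Finset.sum_congr rfl fun v _ => ?_
    split_ifs
    · rw [Finset.sum_mul_sum]
    · simp
  have key := exists_digit (A := (ZMod n × ZMod n) × Fin 64)
    (R := fun a b => TorusAdj a.1 b.1) (δ := 1 / (64 * (n : ℝ) ^ 2)) (ε := 3072 / n)
    (fun _ _ h => h.symm) (fun _ h => h.1 rfl) (by rw [hcard]; field_simp)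
  specialize key ?_ (by positivity) ?_ ?_
  · apply one_div_le_one_div_of_le (by norm_num)
    nlinarith
  · intro m hm
    rw [hlift]
    refine (sum_torusAdj_le fun u => Finset.sum_nonneg fun p _ => hm _).trans ?_
    have e1 : ∑ u, (∑ p, m (u, p)) ^ 2 ≤ 64 * ∑ a, m a ^ 2 := by
      rw [Fintype.sum_prod_type (fun a => m a ^ 2), Finset.mul_sum]
      refine Finset.sum_le_sum fun u _ => ?_
      have := sq_sum_le_card_mul_sum_sq (s := Finset.univ) (f := fun p : Fin 64 => m (u, p))
      simpa using this
    rw [← Fintype.sum_prod_type m]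
    have e2 : 2 * (∑ a, m a) ^ 2 * (1 / (64 * (n : ℝ) ^ 2)) =
        1 / 32 * ((∑ a, m a) ^ 2 / n ^ 2) := by
      field_simp
      ring
    rw [e2]
    linarith
  · have := hlift TorusAdj fun _ => 1
    simp only [mul_one] at this
    rw [this, hcard]
    have e1 := sum_torusAdj_ge hn (by omega)
    have e2 : (512 - 3072 / (n : ℝ)) * (64 * n ^ 2) = 64 ^ 2 * ((8 - 48 / (n : ℝ)) * n ^ 2) := by
      ring
    rw [e2]
    refine (mul_le_mul_of_nonneg_left e1 (by norm_num)).trans (le_of_eq ?_)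
    simp only [Finset.mul_sum]
    refine Finset.sum_congr rfl fun u _ => Finset.sum_congr rfl fun v _ => ?_
    split_ifs <;> norm_num
  obtain ⟨γ, hγ, h1, h2⟩ := key
  have hpos : 0 < 64 * (n : ℝ) ^ 2 := by positivity
  refine ⟨γ, hγ, ?_, ?_⟩
  · rw [← div_le_iff₀ hpos]
    refine le_trans (le_of_eq ?_) (le_sub_iff_add_le'.2 h1)
    ring
  · rw [← le_div_iff₀ hpos]
    refine (sub_le_iff_le_add'.2 h2).trans (le_of_eq ?_)
    ring

theorem exists_interval_three : ∃ α β : ℝ, α < β ∧ ∀ y ∈ Set.Icc α β, LagLimit 3 y := by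
  let N : ℕ → ℕ := fun k => 2 * (k + 10 ^ 18) + 1
  have hN : ∀ k, (N k : ℝ) = 2 * (k + 10 ^ 18) + 1 := fun k => by
    simp only [N]
    push_cast
    ring
  choose g hg hlo hhi using fun k => exists_digit_of_odd (n := N k) ⟨_, rfl⟩
    (by simp only [N]; omega)
  have hN0 : ∀ k, (0 : ℝ) < N k := fun k => by rw [hN]; positivity
  have hNlim : Tendsto (fun k => (N k : ℝ)) atTop atTop := by
    simp only [hN]
    refine tendsto_atTop_add_const_right _ _ (Tendsto.const_mul_atTop two_pos ?_)
    exact tendsto_atTop_add_const_right _ _ tendsto_natCast_atTop_atTop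
  have hNsq : Tendsto (fun k => 64 * (N k : ℝ) ^ 2) atTop atTop :=
    Tendsto.const_mul_atTop (by norm_num) ((tendsto_pow_atTop two_ne_zero).comp hNlim)
  set γ₀ : ℝ := 1 - 1 / 512 ^ 2 with hγ₀
  set θ : ℕ → ℝ := fun k => (g k - γ₀) * (64 * (N k : ℝ) ^ 2) with hθ
  have hθlim : Tendsto θ atTop (nhds (4 / (9 * 512 ^ 5))) := by
    refine tendsto_of_tendsto_of_tendsto_of_le_of_le ?_ ?_ hlo hhi
    · have := (tendsto_const_nhds (x := (9216 : ℝ))).div_atTop hNlim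
      simpa using (tendsto_const_nhds (x := (4 / (9 * 512 ^ 5) : ℝ))).sub this
    · have := ((tendsto_const_nhds (x := (1 : ℝ))).div_atTop hNsq).const_mul (3 * 10 ^ 7)
      simpa using (tendsto_const_nhds (x := (4 / (9 * 512 ^ 5) : ℝ))).add this
  have hθ0 : ∀ k, 0 < θ k := by
    intro k
    refine lt_of_lt_of_le ?_ (hlo k)
    rw [sub_pos, div_lt_iff₀ (hN0 k), hN]
    have : (0 : ℝ) ≤ k := k.cast_nonneg
    norm_num
    linarith
  have hgθ : ∀ k, g k - γ₀ = θ k / (64 * (N k : ℝ) ^ 2) := fun k => by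
    have := (hN0 k).ne'
    simp only [hθ]
    field_simp
  refine exists_interval_of_seq (γ₀ := γ₀) (g := g) (by norm_num [hγ₀]) (by norm_num [hγ₀])
    isLag_digit_base hg (fun k => ?_) ?_ ?_
  · rw [← sub_pos, hgθ]
    have := hN0 k
    have := hθ0 k
    positivity
  · rw [← tendsto_sub_nhds_zero_iff]
    simp only [hgθ]
    exact hθlim.div_atTop hNsq
  · have h1 : Tendsto (fun k => θ k / θ (k + 1)) atTop (nhds 1) := by
      have := hθlim.div (hθlim.comp (tendsto_add_atTop_nat 1)) (by norm_num)
      rwa [div_self (by norm_num)] at this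
    have h2 : Tendsto (fun k => (1 + 2 / (N k : ℝ)) ^ 2) atTop (nhds 1) := by
      have := ((tendsto_const_nhds (x := (1 : ℝ))).add
        ((tendsto_const_nhds (x := (2 : ℝ))).div_atTop hNlim)).pow 2
      simpa using this
    have h3 := h1.mul h2
    rw [one_mul] at h3
    refine h3.congr fun k => ?_
    have e1 : (N (k + 1) : ℝ) = N k + 2 := by
      rw [hN, hN]
      push_cast
      ring
    have e2 := hN0 k
    have e3 := hθ0 (k + 1)
    rw [hgθ, hgθ, e1]
    field_simp

end DigitSequence

/-- For every integer `r ≥ 3` there is `δ_r > 0` with `[1 - δ_r, 1] ⊆ Π^{(r)}_∞`. -/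
theorem terminal_interval_of_turan_densities :
    ∀ r : ℕ, 3 ≤ r → ∃ δ : ℝ, 0 < δ ∧ Set.Icc (1 - δ) 1 ⊆ PiInf r := by
  intro r hr
  obtain ⟨α, β, hαβ, h⟩ := exists_interval_three
  exact terminal_interval_of_three hαβ h r hr
end

section
/- Fix D ≥ 1, θ := 2√(D−1), and an integer k ≥ 2 satisfying (9/7)^{1/3}·k^{−2/3} < 3/(θ+3) and k < 2D/9 + 1, and put α := 1 − 1/k² and c₀ := (2D/3 − 3(k−1))/k² (so c₀ > 0). Let (Γ_j, S_j)_{j≥1} be a sequence where Γ_j is a finite group of order n_j with n_j → ∞, S_j = S_j^{-1} ⊆ Γ_j \ {1} with |S_j| = D, each Cay(Γ_j, S_j) is connected and non-bipartite, and every non-trivial adjacency eigenvalue of Cay(Γ_j, S_j) has absolute value at most θ. Let H_j be the 3-partite 3-graph on three copies of Γ_j with edges {x,y,z} where z = x·s·y for some s ∈ S_j, put m_j := 3n_j, and let Q_j be the 3-graph on k disjoint m_j-vertex parts W₁,…,W_k obtained by placing a copy of H_j inside each W_i and adding every 3-set of vertices not contained in a single part W_i. Then λ(Q_j) = α + (c₀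 + o(1))/m_j as j → ∞. -/
open Filter Finset

/-- The Cayley graph `Cay(Γ,S)`. -/
def cayleyGraph {Γ : Type*} [Group Γ] (S : Finset Γ) : SimpleGraph Γ :=
  SimpleGraph.fromRel (fun g h => ∃ s ∈ S, h = g * s)

/-- The adjacency operator of `Cay(Γ,S)`: `(Mh)(u) = Σ_{s∈S} h(us)`. -/
noncomputable def adjOp {Γ : Type*} [Group Γ] [Fintype Γ] (S : Finset Γ)
    (h : Γ → ℝ) : Γ → ℝ :=
  fun u => ∑ s ∈ S, h (u * s)

/-- The copies of the spectral gadget `H` placed inside each of the `k` parts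
`W_i` (each part is a copy of `Γ ⊕ Γ ⊕ Γ`): within part `i`, `{x,y,z}` is an edge
iff `z = x·s·y` for some `s ∈ S`. -/
def gadgetEdgesIn {Γ : Type*} [Group Γ] [Fintype Γ] [DecidableEq Γ]
    (k : ℕ) (S : Finset Γ) : Finset (Finset (Fin k × (Γ ⊕ Γ ⊕ Γ))) :=
  ((Finset.univ : Finset (Fin k)) ×ˢ (Finset.univ : Finset Γ) ×ˢ
      (Finset.univ : Finset Γ) ×ˢ S).image
    (fun p => {(p.1, Sum.inl p.2.1), (p.1, Sum.inr (Sum.inl p.2.2.1)),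
               (p.1, Sum.inr (Sum.inr (p.2.1 * p.2.2.2 * p.2.2.1)))})

open Classical in
/-- All `3`-sets of vertices not contained in a single part `W_i`. -/
noncomputable def crossEdges (Γ : Type*) [Fintype Γ] (k : ℕ) :
    Finset (Finset (Fin k × (Γ ⊕ Γ ⊕ Γ))) :=
  (Finset.powersetCard 3 (Finset.univ : Finset (Fin k × (Γ ⊕ Γ ⊕ Γ)))).filter
    (fun e => ¬ ∃ i : Fin k, ∀ v ∈ e, v.1 = i)

open Classical in
/-- The edge set of the outer construction `Q`: a copy of the gadget inside each of
the `k` parts, together with all `3`-sets meeting more than one part. -/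
noncomputable def Qedges {Γ : Type*} [Group Γ] [Fintype Γ] [DecidableEq Γ]
    (k : ℕ) (S : Finset Γ) : Finset (Finset (Fin k × (Γ ⊕ Γ ⊕ Γ))) :=
  gadgetEdgesIn k S ∪ crossEdges Γ k

/-- The Lagrangian of a `3`-graph with edge set `E`. -/
noncomputable def lag3 {V : Type*} [Fintype V] (E : Finset (Finset V)) : ℝ :=
  sSup { t : ℝ | ∃ y : V → ℝ, (∀ v, 0 ≤ y v) ∧ (∑ v, y v) = 1 ∧
    t = 6 * ∑ e ∈ E, ∏ v ∈ e, y v }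

theorem Matrix.IsHermitian.dotProduct_mulVec_le {ι : Type*} [Fintype ι] [DecidableEq ι]
    {A : Matrix ι ι ℝ} (hA : A.IsHermitian) {θ : ℝ} (hθ : ∀ i, |hA.eigenvalues i| ≤ θ)
    (x y : ι → ℝ) :
    x ⬝ᵥ A.mulVec y ≤ θ / 2 * (x ⬝ᵥ x + y ⬝ᵥ y) := by
  set b := hA.eigenvectorBasis
  have parseval (f g : ι → ℝ) :
      f ⬝ᵥ g = ∑ i, (f ⬝ᵥ (b i).ofLp) * (g ⬝ᵥ (b i).ofLp) := by
    have := b.sum_inner_mul_inner (WithLp.toLp 2 f) (WithLp.toLp 2 g)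
    simp only [EuclideanSpace.inner_eq_star_dotProduct, star_trivial] at this
    rw [dotProduct_comm, ← this]
    exact Finset.sum_congr rfl fun i _ => by rw [dotProduct_comm f]
  have coeff (i : ι) :
      A.mulVec y ⬝ᵥ (b i).ofLp = hA.eigenvalues i * (y ⬝ᵥ (b i).ofLp) := by
    have hT : A.transpose = A := by simpa using hA.eq
    rw [dotProduct_comm, Matrix.dotProduct_mulVec, ← Matrix.mulVec_transpose, hT,
      hA.mulVec_eigenvectorBasis i, smul_dotProduct, dotProduct_comm, smul_eq_mul]
  rw [parseval x (A.mulVec y), parseval x x, parseval y y, ← Finset.sum_add_distrib,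
    Finset.mul_sum]
  refine Finset.sum_le_sum fun i _ => ?_
  rw [coeff]
  obtain ⟨h1, h2⟩ := abs_le.1 (hθ i)
  nlinarith [mul_nonneg (sub_nonneg.2 h2) (sq_nonneg (x ⬝ᵥ (b i).ofLp + y ⬝ᵥ (b i).ofLp)),
    mul_nonneg (neg_le_iff_add_nonneg.1 h1)
      (sq_nonneg (x ⬝ᵥ (b i).ofLp - y ⬝ᵥ (b i).ofLp))]

theorem adjOp_eq_card_mul_imp_const {Γ : Type*} [Group Γ] [Fintype Γ] {S : Finset Γ}
    (hsymm : ∀ s ∈ S, s⁻¹ ∈ S) (hconn : (cayleyGraph S).Connected) {h : Γ → ℝ}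
    (hh : adjOp S h = fun u => (S.card : ℝ) * h u) (u v : Γ) : h u = h v := by
  obtain ⟨w, hw⟩ := Finite.exists_max h
  have step (g : Γ) (hg : h g = h w) (s : Γ) (hs : s ∈ S) : h (g * s) = h w := by
    have hsum : ∑ s ∈ S, (h w - h (g * s)) = 0 := by
      have := congrFun hh g
      simp only [adjOp] at this
      rw [Finset.sum_sub_distrib, this, hg]
      simp
    have := (Finset.sum_eq_zero_iff_of_nonneg fun s _ => sub_nonneg.2 (hw (g * s))).1 hsum s hs
    linarith
  have key (g : Γ) : h g = h w := by
    obtain ⟨p⟩ := hconn.preconnected g w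
    induction p with
    | nil => rfl
    | cons hadj _ ih =>
      have hv := ih hw step
      rw [cayleyGraph, SimpleGraph.fromRel_adj] at hadj
      obtain ⟨-, ⟨s, hs, rfl⟩ | ⟨s, hs, rfl⟩⟩ := hadj
      · simpa using step _ hv s⁻¹ (hsymm s hs)
      · exact step _ hv s hs
  rw [key u, key v]

/-- The sum of squared deviations of `f` from its mean. -/
noncomputable def sqDev {Γ : Type*} [Fintype Γ] (f : Γ → ℝ) : ℝ :=
  ∑ u, f u ^ 2 - (∑ u, f u) ^ 2 / Fintype.card Γ

theorem sqDev_nonneg {Γ : Type*} [Fintype Γ] (f : Γ → ℝ) : 0 ≤ sqDev f := by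
  have := sq_sum_le_card_mul_sum_sq (s := Finset.univ) (f := f)
  rw [sqDev, sub_nonneg]
  exact div_le_of_le_mul₀ (by positivity) (Finset.sum_nonneg fun _ _ => sq_nonneg _)
    (by rw [mul_comm]; simpa using this)

theorem sqDev_comp_equiv {Γ : Type*} [Fintype Γ] (f : Γ → ℝ) (e : Γ ≃ Γ) :
    sqDev (fun u => f (e u)) = sqDev f := by
  simp only [sqDev]
  rw [Equiv.sum_comp e (fun u => f u ^ 2), Equiv.sum_comp e f]

theorem sum_mul_adjOp_le {Γ : Type*} [Group Γ] [Fintype Γ] [DecidableEq Γ] {S : Finset Γ}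
    {θ : ℝ} (hθ : 0 ≤ θ) (hsymm : ∀ s ∈ S, s⁻¹ ∈ S) (hconn : (cayleyGraph S).Connected)
    (heig : ∀ μ : ℝ, μ ≠ (S.card : ℝ) →
      (∃ h : Γ → ℝ, h ≠ 0 ∧ adjOp S h = fun u => μ * h u) → |μ| ≤ θ)
    (f g : Γ → ℝ) :
    ∑ u, f u * adjOp S g u ≤
      S.card * (∑ u, f u) * (∑ u, g u) / Fintype.card Γ + θ / 2 * (sqDev f + sqDev g) := by
  set n : ℝ := (Fintype.card Γ : ℝ)
  have hn : n ≠ 0 := by simp [n]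
  set N : Matrix Γ Γ ℝ :=
    Matrix.of fun u v => (if u⁻¹ * v ∈ S then (1 : ℝ) else 0) - S.card / n with hNdef
  have hmem (u v : Γ) : u⁻¹ * v ∈ S ↔ v⁻¹ * u ∈ S :=
    ⟨fun h => by simpa using hsymm _ h, fun h => by simpa using hsymm _ h⟩
  have hN : N.IsHermitian := by
    ext u v
    simp [hNdef, hmem u v]
  have hmul (h : Γ → ℝ) (u : Γ) :
      N.mulVec h u = adjOp S h u - S.card / n * ∑ v, h v := by
    simp only [Matrix.mulVec, dotProduct, hNdef, Matrix.of_apply, sub_mul,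
      Finset.sum_sub_distrib, ← Finset.mul_sum, adjOp, ite_mul, one_mul, zero_mul]
    congr 1
    rw [← Equiv.sum_comp (Equiv.mulLeft u)]
    simp [Finset.sum_ite_mem]
  have hsumAdj (h : Γ → ℝ) : ∑ u, adjOp S h u = S.card * ∑ u, h u := by
    simp only [adjOp]
    rw [Finset.sum_comm]
    exact (Finset.sum_congr rfl fun s _ => Equiv.sum_comp (Equiv.mulRight s) h).trans (by simp)
  have hsumN (h : Γ → ℝ) : ∑ u, N.mulVec h u = 0 := by
    simp only [hmul, Finset.sum_sub_distrib, hsumAdj, Finset.sum_const, Finset.card_univ,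
      nsmul_eq_mul]
    change _ - n * _ = 0
    field_simp
    ring
  have hev (i : Γ) : |hN.eigenvalues i| ≤ θ := by
    set μ := hN.eigenvalues i
    set v : Γ → ℝ := (hN.eigenvectorBasis i).ofLp with hv
    have hNv : N.mulVec v = μ • v := hN.mulVec_eigenvectorBasis i
    by_cases hμ : μ = 0
    · simpa [hμ] using hθ
    have hv0 : v ≠ 0 := by
      intro h0
      apply hN.eigenvectorBasis.orthonormal.ne_zero i
      ext u
      exact congrFun h0 u
    have hsum : ∑ u, v u = 0 := by
      have := hsumN v
      rw [hNv] at this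
      simpa [← Finset.mul_sum, hμ] using this
    have hadj : adjOp S v = fun u => μ * v u := by
      ext u
      have := hmul v u
      rw [hNv, hsum] at this
      simpa using this.symm
    refine heig μ (fun hD => hv0 ?_) ⟨v, hv0, hadj⟩
    rw [hD] at hadj
    have hc := adjOp_eq_card_mul_imp_const hsymm hconn hadj
    ext u
    have : n * v u = 0 := by
      rw [← hsum, Finset.sum_congr rfl fun w _ => hc w u]
      simp [n]
    simpa [hn] using this
  set F := ∑ u, f u
  set G := ∑ u, g u
  have hdev (h : Γ → ℝ) :
      (fun u => h u - (∑ u, h u) / n) ⬝ᵥ (fun u => h u - (∑ u, h u) / n) = sqDev h := by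
    simp only [dotProduct, sqDev, sub_mul, mul_sub, Finset.sum_sub_distrib, ← Finset.mul_sum,
      ← Finset.sum_mul, Finset.sum_const, Finset.card_univ, nsmul_eq_mul, sq]
    change _ - _ - (_ - _ * (n * _)) = _ - _ / n
    field_simp
    ring
  have hmain := hN.dotProduct_mulVec_le hev (fun u => f u - F / n) (fun u => g u - G / n)
  rw [hdev f, hdev g] at hmain
  have hN1 : N.mulVec (fun u => g u - G / n) = N.mulVec g := by
    ext u
    simp only [hmul, adjOp, Finset.sum_sub_distrib, Finset.sum_const, Finset.card_univ,
      nsmul_eq_mul]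
    change _ - _ * (G - n * _) = _ - _ * G
    field_simp
    ring
  rw [hN1] at hmain
  simp only [dotProduct, sub_mul, Finset.sum_sub_distrib, ← Finset.mul_sum, hsumN] at hmain
  simp only [hmul, mul_sub, Finset.sum_sub_distrib, ← Finset.sum_mul] at hmain
  change _ - F * (_ * G) - _ ≤ _ at hmain
  have : S.card * F * G / n = F * (S.card / n * G) := by ring
  rw [this]
  linarith

theorem Finset.six_mul_sum_powersetCard_three_prod {V : Type*} [DecidableEq V] (s : Finset V)
    (y : V → ℝ) :
    6 * ∑ e ∈ s.powersetCard 3, ∏ v ∈ e, y v =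
      (∑ v ∈ s, y v) ^ 3 - 3 * (∑ v ∈ s, y v) * ∑ v ∈ s, y v ^ 2 + 2 * ∑ v ∈ s, y v ^ 3 := by
  have insert_sum (s : Finset V) (a : V) (ha : a ∉ s) (r : ℕ) :
      ∑ e ∈ (insert a s).powersetCard (r + 1), ∏ v ∈ e, y v =
        ∑ e ∈ s.powersetCard (r + 1), ∏ v ∈ e, y v +
          y a * ∑ e ∈ s.powersetCard r, ∏ v ∈ e, y v := by
    have hmem (e : Finset V) (he : e ∈ s.powersetCard r) : a ∉ e :=
      fun h => ha ((Finset.mem_powersetCard.1 he).1 h)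
    rw [Finset.powersetCard_succ_insert ha, Finset.sum_union, Finset.sum_image, Finset.mul_sum]
    · congr 1
      exact Finset.sum_congr rfl fun e he => Finset.prod_insert (hmem e he)
    · intro e he e' he' h
      rw [← Finset.erase_insert (hmem e he), ← Finset.erase_insert (hmem e' he'), h]
    · rw [Finset.disjoint_left]
      rintro e he he'
      obtain ⟨e', -, rfl⟩ := Finset.mem_image.1 he'
      exact ha ((Finset.mem_powersetCard.1 he).1 (Finset.mem_insert_self _ _))
  have one (s : Finset V) : ∑ e ∈ s.powersetCard 1, ∏ v ∈ e, y v = ∑ v ∈ s, y v := by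
    simp [Finset.powersetCard_one]
  have two (s : Finset V) : 2 * ∑ e ∈ s.powersetCard 2, ∏ v ∈ e, y v =
      (∑ v ∈ s, y v) ^ 2 - ∑ v ∈ s, y v ^ 2 := by
    induction s using Finset.induction_on with
    | empty => rw [Finset.powersetCard_eq_empty.2 (by simp)]; simp
    | insert a s ha ih =>
      rw [insert_sum s a ha 1, one, Finset.sum_insert ha, Finset.sum_insert ha, mul_add, ih]
      ring
  induction s using Finset.induction_on with
  | empty => rw [Finset.powersetCard_eq_empty.2 (by simp)]; simp
  | insert a s ha ih =>
    rw [insert_sum s a ha 2, Finset.sum_insert ha, Finset.sum_insert ha, Finset.sum_insert ha,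
      mul_add, ih]
    linear_combination 3 * y a * two s

theorem six_mul_sum_crossEdges {Γ : Type*} [Fintype Γ] {k : ℕ}
    (y : Fin k × (Γ ⊕ Γ ⊕ Γ) → ℝ) :
    6 * ∑ e ∈ crossEdges Γ k, ∏ v ∈ e, y v =
      (∑ v, y v) ^ 3 - ∑ i, (∑ u, y (i, u)) ^ 3
        - 3 * ∑ i, (∑ v, y v - ∑ u, y (i, u)) * ∑ u, y (i, u) ^ 2 := by
  classical
  set W : Fin k → Finset (Fin k × (Γ ⊕ Γ ⊕ Γ)) := fun i => {i} ×ˢ Finset.univ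
  have hW (i : Fin k) (f : Fin k × (Γ ⊕ Γ ⊕ Γ) → ℝ) : ∑ v ∈ W i, f v = ∑ u, f (i, u) := by
    simp [W]
  have hinner : (Finset.powersetCard 3 Finset.univ).filter
      (fun e : Finset (Fin k × (Γ ⊕ Γ ⊕ Γ)) => ∃ i : Fin k, ∀ v ∈ e, v.1 = i) =
      Finset.univ.biUnion fun i => (W i).powersetCard 3 := by
    ext e
    simp only [Finset.mem_filter, Finset.mem_powersetCard, Finset.mem_biUnion, Finset.mem_univ,
      true_and, Finset.subset_iff, W, Finset.mem_product,
      Finset.mem_singleton, and_true]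
    tauto
  have hdisj : (↑(Finset.univ : Finset (Fin k)) : Set (Fin k)).PairwiseDisjoint
      fun i => (W i).powersetCard 3 := by
    intro i _ j _ hij
    rw [Function.onFun, Finset.disjoint_left]
    intro e hi hj
    rw [Finset.mem_powersetCard] at hi hj
    obtain ⟨v, hv⟩ := Finset.card_pos.1 (by omega : 0 < e.card)
    have h1 := hi.1 hv
    have h2 := hj.1 hv
    simp only [W, Finset.mem_product, Finset.mem_singleton] at h1 h2
    exact hij (h1.1.symm.trans h2.1)
  have hsplit := Finset.sum_filter_add_sum_filter_not
    (Finset.powersetCard 3 (Finset.univ : Finset (Fin k × (Γ ⊕ Γ ⊕ Γ))))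
    (fun e => ∃ i : Fin k, ∀ v ∈ e, v.1 = i) (fun e => ∏ v ∈ e, y v)
  rw [hinner, Finset.sum_biUnion hdisj] at hsplit
  have htot := Finset.six_mul_sum_powersetCard_three_prod Finset.univ y
  have hparts : 6 * ∑ i, ∑ e ∈ (W i).powersetCard 3, ∏ v ∈ e, y v =
      ∑ i, ((∑ u, y (i, u)) ^ 3 - 3 * (∑ u, y (i, u)) * ∑ u, y (i, u) ^ 2
        + 2 * ∑ u, y (i, u) ^ 3) := by
    rw [Finset.mul_sum]
    refine Finset.sum_congr rfl fun i _ => ?_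
    rw [Finset.six_mul_sum_powersetCard_three_prod, hW, hW i fun v => y v ^ 2,
      hW i fun v => y v ^ 3]
  have h2 : ∑ v, y v ^ 2 = ∑ i, ∑ u, y (i, u) ^ 2 := Fintype.sum_prod_type _
  have h3 : ∑ v, y v ^ 3 = ∑ i, ∑ u, y (i, u) ^ 3 := Fintype.sum_prod_type _
  simp only [Finset.sum_add_distrib, Finset.sum_sub_distrib, mul_assoc, ← Finset.mul_sum]
    at hparts
  simp only [sub_mul, Finset.sum_sub_distrib, ← Finset.mul_sum]
  rw [h2, h3] at htot
  rw [crossEdges]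
  linear_combination 6 * hsplit + htot - hparts

theorem mem_crossEdges {Γ : Type*} [Fintype Γ] {k : ℕ} {e : Finset (Fin k × (Γ ⊕ Γ ⊕ Γ))} :
    e ∈ crossEdges Γ k ↔ e.card = 3 ∧ ¬ ∃ i : Fin k, ∀ v ∈ e, v.1 = i := by
  simp [crossEdges]

theorem sum_Qedges {Γ : Type*} [Group Γ] [Fintype Γ] [DecidableEq Γ] {k : ℕ} (S : Finset Γ)
    (y : Fin k × (Γ ⊕ Γ ⊕ Γ) → ℝ) :
    ∑ e ∈ Qedges k S, ∏ v ∈ e, y v =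
      ∑ i, ∑ p, ∑ q, ∑ s ∈ S, y (i, Sum.inl p) * y (i, Sum.inr (Sum.inl q)) *
          y (i, Sum.inr (Sum.inr (p * s * q))) +
        ∑ e ∈ crossEdges Γ k, ∏ v ∈ e, y v := by
  classical
  have hdisj : Disjoint (gadgetEdgesIn k S) (crossEdges Γ k) := by
    rw [Finset.disjoint_left]
    intro e he hc
    rw [gadgetEdgesIn, Finset.mem_image] at he
    rw [mem_crossEdges] at hc
    obtain ⟨p, -, hp⟩ := he
    refine hc.2 ⟨p.1, fun v hv => ?_⟩
    rw [← hp, Finset.mem_insert, Finset.mem_insert, Finset.mem_singleton] at hv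
    obtain hv | hv | hv := hv <;> rw [hv]
  rw [Qedges, Finset.sum_union hdisj]
  congr 1
  rw [gadgetEdgesIn, Finset.sum_image]
  · simp only [Finset.sum_product]
    refine Finset.sum_congr rfl fun i _ => Finset.sum_congr rfl fun p _ =>
      Finset.sum_congr rfl fun q _ => Finset.sum_congr rfl fun s _ => ?_
    rw [Finset.prod_insert (by simp), Finset.prod_insert (by simp), Finset.prod_singleton,
      ← mul_assoc]
  · rintro ⟨i, p, q, s⟩ - ⟨i', p', q', s'⟩ - h
    have h1 := Finset.ext_iff.1 h (i, Sum.inl p)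
    have h2 := Finset.ext_iff.1 h (i, Sum.inr (Sum.inl q))
    have h3 := Finset.ext_iff.1 h (i, Sum.inr (Sum.inr (p * s * q)))
    simp at h1 h2 h3
    obtain ⟨rfl, rfl⟩ := h1
    obtain ⟨-, rfl⟩ := h2
    simpa using h3

/-- The weighted number of triples `(p, q, p * s * q)` with `s ∈ S`. -/
noncomputable def tripleSum {Γ : Type*} [Group Γ] [Fintype Γ] (S : Finset Γ)
    (a b c : Γ → ℝ) : ℝ :=
  ∑ p, ∑ q, ∑ s ∈ S, a p * b q * c (p * s * q)

theorem tripleSum_le_prod {Γ : Type*} [Group Γ] [Fintype Γ] (S : Finset Γ) {a b c : Γ → ℝ}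
    (ha : ∀ u, 0 ≤ a u) (hb : ∀ u, 0 ≤ b u) (hc : ∀ u, 0 ≤ c u) :
    tripleSum S a b c ≤ (∑ u, a u) * (∑ u, b u) * ∑ u, c u := by
  rw [Finset.sum_mul_sum, Finset.sum_mul, tripleSum]
  refine Finset.sum_le_sum fun p _ => ?_
  rw [Finset.sum_mul]
  refine Finset.sum_le_sum fun q _ => ?_
  rw [← Finset.mul_sum]
  refine mul_le_mul_of_nonneg_left ?_ (mul_nonneg (ha p) (hb q))
  calc ∑ s ∈ S, c (p * s * q) ≤ ∑ s, c (p * s * q) :=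
        Finset.sum_le_univ_sum_of_nonneg fun _ => hc _
    _ = ∑ u, c u := Equiv.sum_comp ((Equiv.mulLeft p).trans (Equiv.mulRight q)) c

theorem six_mul_tripleSum_le {Γ : Type*} [Group Γ] [Fintype Γ] [DecidableEq Γ] {S : Finset Γ}
    {θ : ℝ} (hθ : 0 ≤ θ) (hsymm : ∀ s ∈ S, s⁻¹ ∈ S) (hconn : (cayleyGraph S).Connected)
    (heig : ∀ μ : ℝ, μ ≠ (S.card : ℝ) →
      (∃ h : Γ → ℝ, h ≠ 0 ∧ adjOp S h = fun u => μ * h u) → |μ| ≤ θ)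
    {a b c : Γ → ℝ} (ha : ∀ u, 0 ≤ a u) (hb : ∀ u, 0 ≤ b u) (hc : ∀ u, 0 ≤ c u) :
    6 * tripleSum S a b c ≤
      6 * S.card * (∑ u, a u) * (∑ u, b u) * (∑ u, c u) / Fintype.card Γ +
        θ * (∑ u, a u + ∑ u, b u + ∑ u, c u) * (sqDev a + sqDev b + sqDev c) := by
  have bound (f g : Γ → ℝ) (e : Γ ≃ Γ) :
      ∑ u, f u * adjOp S (fun u => g (e u)) u ≤ S.card * (∑ u, f u) * (∑ u, g u) /
        Fintype.card Γ + θ / 2 * (sqDev f + sqDev g) := by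
    have := sum_mul_adjOp_le hθ hsymm hconn heig f fun u => g (e u)
    rwa [sqDev_comp_equiv, Equiv.sum_comp e g] at this
  have weighted (h : Γ → ℝ) (hh : ∀ u, 0 ≤ h u) (f g : Γ → ℝ) (e : Γ → Γ ≃ Γ) :
      ∑ w, h w * ∑ u, f u * adjOp S (fun u => g (e w u)) u ≤
        (∑ u, h u) * (S.card * (∑ u, f u) * (∑ u, g u) / Fintype.card Γ +
          θ / 2 * (sqDev f + sqDev g)) := by
    rw [Finset.sum_mul]
    exact Finset.sum_le_sum fun w _ => mul_le_mul_of_nonneg_left (bound f g (e w)) (hh w)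
  have hB : tripleSum S a b c =
      ∑ q, b q * ∑ p, a p * adjOp S (fun u => c (Equiv.mulRight q u)) p := by
    rw [tripleSum, Finset.sum_comm]
    refine Finset.sum_congr rfl fun q _ => ?_
    simp only [Finset.mul_sum, adjOp, Equiv.coe_mulRight]
    exact Finset.sum_congr rfl fun p _ => Finset.sum_congr rfl fun s _ => by ring
  have hC : tripleSum S a b c =
      ∑ r, c r * ∑ p, a p * adjOp S
        (fun u => b (((Equiv.inv Γ).trans (Equiv.mulRight r)) u)) p := by
    simp only [tripleSum, Finset.mul_sum, adjOp]
    conv_rhs => rw [Finset.sum_comm]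
    refine Finset.sum_congr rfl fun p _ => ?_
    rw [Finset.sum_comm]
    conv_rhs => rw [Finset.sum_comm]
    refine Finset.sum_congr rfl fun s _ => ?_
    refine Eq.trans (Finset.sum_congr rfl fun q _ => ?_) (Equiv.sum_comp (Equiv.mulLeft (p * s)) _)
    simp [mul_assoc]
    ring
  have hA : tripleSum S a b c =
      ∑ p, a p * ∑ q, (fun u => b u⁻¹) q * adjOp S
        (fun u => c (((Equiv.inv Γ).trans (Equiv.mulLeft p)) u)) q := by
    rw [tripleSum]
    refine Finset.sum_congr rfl fun p _ => ?_
    rw [← Equiv.sum_comp (Equiv.inv Γ)]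
    simp only [Finset.mul_sum, adjOp]
    refine Finset.sum_congr rfl fun q _ => ?_
    refine Finset.sum_nbij' (fun s => s⁻¹) (fun s => s⁻¹) hsymm hsymm (by simp) (by simp) ?_
    intro s _
    simp [mul_assoc]
  have h1 := weighted b hb a c fun q => Equiv.mulRight q
  have h2 := weighted c hc a b fun r => (Equiv.inv Γ).trans (Equiv.mulRight r)
  have h3 := weighted a ha (fun u => b u⁻¹) c fun p => (Equiv.inv Γ).trans (Equiv.mulLeft p)
  rw [← hB] at h1
  rw [← hC] at h2
  rw [← hA, show sqDev (fun u => b u⁻¹) = sqDev b from sqDev_comp_equiv b (Equiv.inv Γ),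
    show ∑ u, b u⁻¹ = ∑ u, b u from Equiv.sum_comp (Equiv.inv Γ) b] at h3
  have hA0 : 0 ≤ ∑ u, a u := Finset.sum_nonneg fun u _ => ha u
  have hB0 : 0 ≤ ∑ u, b u := Finset.sum_nonneg fun u _ => hb u
  have hC0 : 0 ≤ ∑ u, c u := Finset.sum_nonneg fun u _ => hc u
  have hrest : 0 ≤ θ * ((∑ u, a u) * sqDev a + (∑ u, b u) * sqDev b + (∑ u, c u) * sqDev c) := by
    have := sqDev_nonneg a
    have := sqDev_nonneg b
    have := sqDev_nonneg c
    positivity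
  linear_combination 2 * h1 + 2 * h2 + 2 * h3 + hrest

theorem mul_mul_le_add_pow_three {x y z : ℝ} (hx : 0 ≤ x) (hy : 0 ≤ y) (hz : 0 ≤ z) :
    27 * (x * y * z) ≤ (x + y + z) ^ 3 := by
  nlinarith [mul_nonneg hx (sq_nonneg (y - z)), mul_nonneg hy (sq_nonneg (x - z)),
    mul_nonneg hz (sq_nonneg (x - y)), mul_nonneg hx (sq_nonneg (x - y)),
    mul_nonneg hx (sq_nonneg (x - z)), mul_nonneg hy (sq_nonneg (y - x)),
    mul_nonneg hy (sq_nonneg (y - z)), mul_nonneg hz (sq_nonneg (z - x)),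
    mul_nonneg hz (sq_nonneg (z - y))]

theorem inv_sq_le_sum_pow_three {k : ℕ} {w : Fin k → ℝ} (hk : 0 < k) (hw : ∀ i, 0 ≤ w i)
    (hsum : ∑ i, w i = 1) : 1 / (k : ℝ) ^ 2 ≤ ∑ i, w i ^ 3 := by
  have hk' : (0 : ℝ) < k := by exact_mod_cast hk
  have htangent (i : Fin k) : 3 * (1 / (k : ℝ)) ^ 2 * w i - 2 * (1 / (k : ℝ)) ^ 3 ≤ w i ^ 3 := by
    have h0 : 0 ≤ w i + 2 * (1 / (k : ℝ)) := add_nonneg (hw i) (by positivity)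
    linear_combination mul_nonneg (sq_nonneg (w i - 1 / (k : ℝ))) h0
  have := Finset.sum_le_sum fun i (_ : i ∈ Finset.univ) => htangent i
  rw [Finset.sum_sub_distrib, ← Finset.mul_sum, hsum] at this
  simp only [Finset.sum_const, Finset.card_univ, Fintype.card_fin, nsmul_eq_mul] at this
  refine le_trans (le_of_eq ?_) this
  field_simp
  ring

theorem inv_le_sum_sq {k : ℕ} {w : Fin k → ℝ} (hk : 0 < k) (hsum : ∑ i, w i = 1) :
    1 / (k : ℝ) ≤ ∑ i, w i ^ 2 := by
  have := sq_sum_le_card_mul_sum_sq (s := Finset.univ) (f := w)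
  rw [hsum, Finset.card_univ, Fintype.card_fin] at this
  rw [div_le_iff₀' (by exact_mod_cast hk)]
  linarith

/-- The Lagrangian polynomial of the outer construction, in terms of part weights. -/
theorem six_mul_sum_Qedges {Γ : Type*} [Group Γ] [Fintype Γ] [DecidableEq Γ] {k : ℕ}
    (S : Finset Γ) {y : Fin k × (Γ ⊕ Γ ⊕ Γ) → ℝ} (hsum : ∑ v, y v = 1) :
    6 * ∑ e ∈ Qedges k S, ∏ v ∈ e, y v =
      1 - ∑ i, (∑ u, y (i, u)) ^ 3
        - 3 * ∑ i, (1 - ∑ u, y (i, u)) * ∑ u, y (i, u) ^ 2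
        + ∑ i, 6 * tripleSum S (fun u => y (i, Sum.inl u)) (fun u => y (i, Sum.inr (Sum.inl u)))
          (fun u => y (i, Sum.inr (Sum.inr u))) := by
  rw [sum_Qedges, mul_add, six_mul_sum_crossEdges, hsum, Finset.mul_sum]
  simp only [tripleSum]
  ring

theorem part_contribution_le {Γ : Type*} [Group Γ] [Fintype Γ] [DecidableEq Γ] {S : Finset Γ}
    {θ : ℝ} (hθ : 0 ≤ θ) (hsymm : ∀ s ∈ S, s⁻¹ ∈ S) (hconn : (cayleyGraph S).Connected)
    (heig : ∀ μ : ℝ, μ ≠ (S.card : ℝ) →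
      (∃ h : Γ → ℝ, h ≠ 0 ∧ adjOp S h = fun u => μ * h u) → |μ| ≤ θ)
    {y : Γ ⊕ Γ ⊕ Γ → ℝ} (hy : ∀ u, 0 ≤ y u) (hw : ∑ u, y u ≤ 3 / (θ + 3)) :
    6 * tripleSum S (fun u => y (Sum.inl u)) (fun u => y (Sum.inr (Sum.inl u)))
        (fun u => y (Sum.inr (Sum.inr u))) - 3 * ((1 - ∑ u, y u) * ∑ u, y u ^ 2) ≤
      ((2 * S.card / 9 + 1) * (∑ u, y u) ^ 3 - (∑ u, y u) ^ 2) / Fintype.card Γ := by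
  set a : Γ → ℝ := fun u => y (Sum.inl u)
  set b : Γ → ℝ := fun u => y (Sum.inr (Sum.inl u))
  set c : Γ → ℝ := fun u => y (Sum.inr (Sum.inr u))
  have hT := six_mul_tripleSum_le hθ hsymm hconn heig (a := a) (b := b) (c := c)
    (fun _ => hy _) (fun _ => hy _) (fun _ => hy _)
  have hn : (0 : ℝ) < Fintype.card Γ := by exact_mod_cast Fintype.card_pos
  have hA0 : 0 ≤ ∑ u, a u := Finset.sum_nonneg fun u _ => hy _
  have hB0 : 0 ≤ ∑ u, b u := Finset.sum_nonneg fun u _ => hy _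
  have hC0 : 0 ≤ ∑ u, c u := Finset.sum_nonneg fun u _ => hy _
  have hws : ∑ u, y u = ∑ u, a u + ∑ u, b u + ∑ u, c u := by
    simp [Fintype.sum_sum_type, a, b, c, add_assoc]
  have hqs : ∑ u, y u ^ 2 = sqDev a + sqDev b + sqDev c +
      ((∑ u, a u) ^ 2 + (∑ u, b u) ^ 2 + (∑ u, c u) ^ 2) / Fintype.card Γ := by
    simp only [Fintype.sum_sum_type, a, b, c, sqDev]
    ring
  have hr : 0 ≤ sqDev a + sqDev b + sqDev c :=
    add_nonneg (add_nonneg (sqDev_nonneg a) (sqDev_nonneg b)) (sqDev_nonneg c)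
  rw [hws] at hw
  rw [hws, hqs]
  set A := ∑ u, a u
  set B := ∑ u, b u
  set C := ∑ u, c u
  have hw' : (A + B + C) * (θ + 3) ≤ 3 := (le_div_iff₀ (by positivity)).1 hw
  have hw1 : A + B + C ≤ 1 := by nlinarith [mul_nonneg (add_nonneg (add_nonneg hA0 hB0) hC0) hθ]
  have hamgm := mul_mul_le_add_pow_three hA0 hB0 hC0
  have hsq : (A + B + C) ^ 2 ≤ 3 * (A ^ 2 + B ^ 2 + C ^ 2) := by
    nlinarith [sq_nonneg (A - B), sq_nonneg (A - C), sq_nonneg (B - C)]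
  have h1 := mul_le_mul_of_nonneg_right hw' hr
  have h2 : 6 * S.card * A * B * C / Fintype.card Γ
      - 3 * (1 - (A + B + C)) * ((A ^ 2 + B ^ 2 + C ^ 2) / Fintype.card Γ) ≤
      ((2 * S.card / 9 + 1) * (A + B + C) ^ 3 - (A + B + C) ^ 2) / Fintype.card Γ := by
    rw [mul_div_assoc', ← sub_div]
    refine div_le_div_of_nonneg_right ?_ hn.le
    have h3 := mul_le_mul_of_nonneg_left hamgm (Nat.cast_nonneg (α := ℝ) S.card)
    have h4 := mul_le_mul_of_nonneg_left hsq (sub_nonneg.2 hw1)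
    linear_combination 2 / 9 * h3 + h4
  linear_combination hT + h1 + h2

theorem six_mul_sum_Qedges_le {Γ : Type*} [Group Γ] [Fintype Γ] [DecidableEq Γ] {S : Finset Γ}
    {k : ℕ} {θ : ℝ} (hθ : 0 ≤ θ) (hk : 0 < k)
    (hk1 : ((9 : ℝ) / 7) ^ ((1 : ℝ) / 3) * (k : ℝ) ^ (-(2 : ℝ) / 3) < 3 / (θ + 3))
    (hk3 : (k : ℝ) ≤ 2 * (S.card : ℝ) / 9 + 1)
    (hsymm : ∀ s ∈ S, s⁻¹ ∈ S) (hconn : (cayleyGraph S).Connected)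
    (heig : ∀ μ : ℝ, μ ≠ (S.card : ℝ) →
      (∃ h : Γ → ℝ, h ≠ 0 ∧ adjOp S h = fun u => μ * h u) → |μ| ≤ θ)
    (hn : 2 * (S.card : ℝ) / 9 + 1 ≤ Fintype.card Γ)
    {y : Fin k × (Γ ⊕ Γ ⊕ Γ) → ℝ} (hy : ∀ v, 0 ≤ y v) (hsum : ∑ v, y v = 1) :
    6 * ∑ e ∈ Qedges k S, ∏ v ∈ e, y v ≤ 1 - 1 / (k : ℝ) ^ 2 +
      ((2 * S.card / 9 + 1) / k ^ 2 - 1 / k) / Fintype.card Γ := by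
  have hk' : (0 : ℝ) < k := by exact_mod_cast hk
  have hn0 : (0 : ℝ) < Fintype.card Γ := by exact_mod_cast Fintype.card_pos
  rw [six_mul_sum_Qedges S hsum]
  set w : Fin k → ℝ := fun i => ∑ u, y (i, u) with hwdef
  have hw0 (i : Fin k) : 0 ≤ w i := Finset.sum_nonneg fun u _ => hy _
  have hwsum : ∑ i, w i = 1 := by rw [← hsum, Fintype.sum_prod_type]
  have hw1 (i : Fin k) : w i ≤ 1 :=
    hwsum ▸ Finset.single_le_sum (fun j _ => hw0 j) (Finset.mem_univ i)
  have hcube := inv_sq_le_sum_pow_three hk hw0 hwsum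
  have hsq := inv_le_sum_sq hk hwsum
  by_cases hsmall : ∀ i, w i ≤ 3 / (θ + 3)
  · have hparts := Finset.sum_le_sum fun i (_ : i ∈ Finset.univ) =>
      part_contribution_le hθ hsymm hconn heig (fun u => hy (i, u)) (hsmall i)
    simp only [Finset.sum_sub_distrib, ← Finset.mul_sum, ← Finset.sum_div] at hparts ⊢
    have hcoef : 0 ≤ 1 - (2 * (S.card : ℝ) / 9 + 1) / Fintype.card Γ :=
      sub_nonneg.2 ((div_le_one hn0).2 hn)
    have h1 := mul_le_mul_of_nonneg_left hcube hcoef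
    have h2 := div_le_div_of_nonneg_right hsq hn0.le
    linear_combination hparts + h1 + h2
  · push Not at hsmall
    obtain ⟨i, hi⟩ := hsmall
    have htriple (j : Fin k) : 6 * tripleSum S (fun u => y (j, Sum.inl u))
        (fun u => y (j, Sum.inr (Sum.inl u))) (fun u => y (j, Sum.inr (Sum.inr u))) ≤
        2 / 9 * w j ^ 3 := by
      have hT := tripleSum_le_prod S (a := fun u => y (j, Sum.inl u))
        (b := fun u => y (j, Sum.inr (Sum.inl u))) (c := fun u => y (j, Sum.inr (Sum.inr u)))
        (fun _ => hy _) (fun _ => hy _) (fun _ => hy _)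
      have hamgm := mul_mul_le_add_pow_three
        (Finset.sum_nonneg fun u (_ : u ∈ Finset.univ) => hy (j, Sum.inl u))
        (Finset.sum_nonneg fun u (_ : u ∈ Finset.univ) => hy (j, Sum.inr (Sum.inl u)))
        (Finset.sum_nonneg fun u (_ : u ∈ Finset.univ) => hy (j, Sum.inr (Sum.inr u)))
      have hwj : w j = ∑ u, y (j, Sum.inl u) + ∑ u, y (j, Sum.inr (Sum.inl u)) +
          ∑ u, y (j, Sum.inr (Sum.inr u)) := by
        simp [hwdef, Fintype.sum_sum_type, add_assoc]
      rw [hwj]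
      linarith
    have hT := Finset.sum_le_sum fun j (_ : j ∈ Finset.univ) => htriple j
    rw [← Finset.mul_sum _ _ (2 / 9 : ℝ)] at hT
    have hpos : 0 ≤ ∑ j, (1 - w j) * ∑ u, y (j, u) ^ 2 :=
      Finset.sum_nonneg fun j _ => mul_nonneg (sub_nonneg.2 (hw1 j))
        (Finset.sum_nonneg fun u _ => sq_nonneg _)
    have hthreshold : (((9 : ℝ) / 7) ^ ((1 : ℝ) / 3) * (k : ℝ) ^ (-(2 : ℝ) / 3)) ^ 3 =
        9 / 7 * (1 / (k : ℝ) ^ 2) := by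
      rw [mul_pow, ← Real.rpow_mul_natCast (by norm_num), ← Real.rpow_mul_natCast hk'.le]
      norm_num
    have hbig : 9 / 7 * (1 / (k : ℝ) ^ 2) ≤ ∑ j, w j ^ 3 :=
      hthreshold ▸ (pow_le_pow_left₀ (by positivity) (hk1.trans hi).le 3).trans
        (Finset.single_le_sum (f := fun j => w j ^ 3) (fun j _ => pow_nonneg (hw0 j) 3)
          (Finset.mem_univ i))
    have hgain : 0 ≤ ((2 * (S.card : ℝ) / 9 + 1) / k ^ 2 - 1 / k) / Fintype.card Γ := by
      refine div_nonneg (sub_nonneg.2 ?_) hn0.le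
      rw [div_le_div_iff₀ hk' (by positivity)]
      nlinarith
    linarith

theorem lag3_Qedges {Γ : Type*} [Group Γ] [Fintype Γ] [DecidableEq Γ] {S : Finset Γ}
    {k : ℕ} {θ : ℝ} (hθ : 0 ≤ θ) (hk : 0 < k)
    (hk1 : ((9 : ℝ) / 7) ^ ((1 : ℝ) / 3) * (k : ℝ) ^ (-(2 : ℝ) / 3) < 3 / (θ + 3))
    (hk3 : (k : ℝ) ≤ 2 * (S.card : ℝ) / 9 + 1)
    (hsymm : ∀ s ∈ S, s⁻¹ ∈ S) (hconn : (cayleyGraph S).Connected)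
    (heig : ∀ μ : ℝ, μ ≠ (S.card : ℝ) →
      (∃ h : Γ → ℝ, h ≠ 0 ∧ adjOp S h = fun u => μ * h u) → |μ| ≤ θ)
    (hn : 2 * (S.card : ℝ) / 9 + 1 ≤ Fintype.card Γ) :
    lag3 (Qedges k S) = 1 - 1 / (k : ℝ) ^ 2 +
      ((2 * S.card / 9 + 1) / k ^ 2 - 1 / k) / Fintype.card Γ := by
  have hk' : (0 : ℝ) < k := by exact_mod_cast hk
  have hn0 : (0 : ℝ) < Fintype.card Γ := by exact_mod_cast Fintype.card_pos
  refine IsGreatest.csSup_eq ⟨?_, ?_⟩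
  · have hsum : ∑ _v : Fin k × (Γ ⊕ Γ ⊕ Γ), 1 / (3 * (k : ℝ) * Fintype.card Γ) = 1 := by
      simp only [Finset.sum_const, Finset.card_univ, Fintype.card_prod, Fintype.card_sum,
        Fintype.card_fin, nsmul_eq_mul]
      push_cast
      field_simp
      ring
    refine ⟨fun _ => 1 / (3 * (k : ℝ) * Fintype.card Γ), fun _ => by positivity, hsum, ?_⟩
    rw [six_mul_sum_Qedges S hsum]
    simp only [tripleSum, Finset.sum_const, Finset.card_univ, Fintype.card_sum,
      Fintype.card_fin, nsmul_eq_mul]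
    push_cast
    field_simp
    ring
  · rintro t ⟨y, hy, hsum, rfl⟩
    exact six_mul_sum_Qedges_le hθ hk hk1 hk3 hsymm hconn heig hn hy hsum

/-- With `D ≥ 1`, `θ = 2√(D−1)`, `k ≥ 2` satisfying `(9/7)^{1/3}·k^{−2/3} < 3/(θ+3)`
and `k < 2D/9 + 1`, `α = 1 − 1/k²` and `c₀ = (2D/3 − 3(k−1))/k²`, and a sequence of
groups `Γ_j` of orders `n_j → ∞` carrying symmetric sets `S_j` of size `D` whose
Cayley graphs are connected, non-bipartite, with non-trivial eigenvalues at most `θ`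
in absolute value, the outer construction `Q_j` (with `m_j = 3n_j` vertices in each
of its `k` parts) satisfies `λ(Q_j) = α + (c₀ + o(1))/m_j` as `j → ∞`. -/
theorem outer_construction_lagrangian
    (Γ : ℕ → Type*) [∀ j, Group (Γ j)] [∀ j, Fintype (Γ j)] [∀ j, DecidableEq (Γ j)]
    (S : ∀ j, Finset (Γ j))
    (D k : ℕ) (θ α c₀ : ℝ)
    (hD : 1 ≤ D)
    (hθ : θ = 2 * Real.sqrt ((D : ℝ) - 1))
    (hk2 : 2 ≤ k)
    (hk1 : ((9 : ℝ) / 7) ^ ((1 : ℝ) / 3) * (k : ℝ) ^ (-(2 : ℝ) / 3) < 3 / (θ + 3))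
    (hk3 : (k : ℝ) < 2 * (D : ℝ) / 9 + 1)
    (hα : α = 1 - 1 / (k : ℝ) ^ 2)
    (hc₀ : c₀ = (2 * (D : ℝ) / 3 - 3 * ((k : ℝ) - 1)) / (k : ℝ) ^ 2)
    (hS1 : ∀ j, (1 : Γ j) ∉ S j)
    (hSsymm : ∀ j, ∀ s ∈ S j, s⁻¹ ∈ S j)
    (hScard : ∀ j, (S j).card = D)
    (hconn : ∀ j, (cayleyGraph (S j)).Connected)
    (hnonbip : ∀ j, ¬ (cayleyGraph (S j)).Colorable 2)
    (heig : ∀ j, ∀ μ : ℝ, μ ≠ (D : ℝ) →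
      (∃ h : Γ j → ℝ, h ≠ 0 ∧ adjOp (S j) h = fun u => μ * h u) → |μ| ≤ θ)
    (hn : Tendsto (fun j => Fintype.card (Γ j)) atTop atTop) :
    Tendsto (fun j => (3 * (Fintype.card (Γ j) : ℝ)) * (lag3 (Qedges k (S j)) - α))
      atTop (nhds c₀) := by
  have hk : (0 : ℝ) < k := by exact_mod_cast (by omega : 0 < k)
  have hθ0 : 0 ≤ θ := hθ ▸ by positivity
  refine tendsto_const_nhds.congr' ?_
  filter_upwards [hn.eventually_ge_atTop (D + 1)] with j hj
  have hn0 : (0 : ℝ) < Fintype.card (Γ j) := by exact_mod_cast (by omega : 0 < _)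
  have hj' : (D : ℝ) + 1 ≤ Fintype.card (Γ j) := by exact_mod_cast hj
  have hDS : (D : ℝ) = (S j).card := by rw [hScard j]
  have hlag := lag3_Qedges hθ0 (by omega : 0 < k) hk1 (hDS ▸ hk3.le) (hSsymm j) (hconn j)
    (hDS ▸ heig j) (by rw [← hDS]; linarith [(Nat.cast_nonneg D : (0 : ℝ) ≤ D)])
  rw [hlag, hα, hc₀, ← hDS]
  field_simp
  ring
end

section
/- For every finite 3-graph G and every k ∈ {1,2,3,4,5,6}, there exists a finite palette P with Λ(P) = (k/6)·λ(G); that is, (k/6)·Λ^{(3)} ⊆ Λ^{(3)}_pal, where Λ^{(3)} is the set of Lagrangians of finite 3-graphs and Λ^{(3)}_pal is the set of finite palette Lagrangians. -/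
/-- The Lagrangian of a finite `3`-graph on vertex set `Fin n` with edge set `E`:
the maximum of `3!·Σ_{e∈E} Π_{v∈e} y_v` over probability vectors `y`. -/
noncomputable def lag3graph (n : ℕ) (E : Finset (Finset (Fin n))) : ℝ :=
  sSup { t : ℝ | ∃ y : Fin n → ℝ, (∀ v, 0 ≤ y v) ∧ (∑ v, y v) = 1 ∧
    t = 6 * ∑ e ∈ E, ∏ v ∈ e, y v }

/-- The Lagrangian of a finite palette with color set `Fin c` and set `T` of
admissible ordered triples: the maximum of `Σ_{(a,b,c)∈T} x_a x_b x_c` over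
probability vectors `x` on the colors. -/
noncomputable def paletteLagrangian (c : ℕ) (T : Finset (Fin c × Fin c × Fin c)) : ℝ :=
  sSup { t : ℝ | ∃ x : Fin c → ℝ, (∀ i, 0 ≤ x i) ∧ (∑ i, x i) = 1 ∧
    t = ∑ p ∈ T, x p.1 * x p.2.1 * x p.2.2 }

/-- A `3`-element set has at least six orderings. -/
theorem six_le_card_orderings {α : Type*} [Fintype α] [DecidableEq α] {e : Finset α}
    (he : e.card = 3) :
    6 ≤ (Finset.univ.filter fun p : α × α × α => ({p.1, p.2.1, p.2.2} : Finset α) = e).card := by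
  obtain ⟨a, b, c, hab, hac, hbc, rfl⟩ := Finset.card_eq_three.1 he
  have hcard : ({(a, b, c), (a, c, b), (b, a, c), (b, c, a), (c, a, b), (c, b, a)} :
      Finset (α × α × α)).card = 6 := by
    simp [Finset.card_insert_of_notMem, hab, hac, hbc, hab.symm, hac.symm, hbc.symm]
  rw [← hcard]
  refine Finset.card_le_card fun p hp => ?_
  simp only [Finset.mem_insert, Finset.mem_singleton] at hp
  rw [Finset.mem_filter]
  refine ⟨Finset.mem_univ _, ?_⟩
  rcases hp with rfl | rfl | rfl | rfl | rfl | rfl <;> grind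

/-- The monomial of an ordering of a `3`-element set is the monomial of the set. -/
theorem mul_eq_prod_of_ordering {α : Type*} [DecidableEq α] {e : Finset α}
    (he : e.card = 3) {p : α × α × α} (hp : ({p.1, p.2.1, p.2.2} : Finset α) = e) (x : α → ℝ) :
    x p.1 * x p.2.1 * x p.2.2 = ∏ v ∈ e, x v := by
  obtain ⟨a, b, c⟩ := p
  subst hp
  have hab : a ≠ b := by
    rintro rfl
    have := Finset.card_le_two (a := a) (b := c)
    simp_all
  have hac : a ≠ c := by
    rintro rfl
    have := Finset.card_le_two (a := a) (b := b)
    simp_all [Finset.pair_comm]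
  have hbc : b ≠ c := by
    rintro rfl
    have := Finset.card_le_two (a := a) (b := b)
    simp_all
  rw [Finset.prod_insert (by simp [hab, hac]), Finset.prod_pair hbc, mul_assoc]

/-- Keeping exactly `k` orderings of every edge gives a palette whose Lagrange polynomial is
`k` times that of the `3`-graph. -/
theorem exists_palette_sum_eq {α : Type*} [Fintype α] [DecidableEq α] (E : Finset (Finset α))
    (hE : ∀ e ∈ E, e.card = 3) {k : ℕ} (hk : k ≤ 6) :
    ∃ T : Finset (α × α × α), ∀ x : α → ℝ,
      ∑ p ∈ T, x p.1 * x p.2.1 * x p.2.2 = k * ∑ e ∈ E, ∏ v ∈ e, x v := by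
  have hsub : ∀ e : Finset α, ∃ S : Finset (α × α × α),
      (∀ p ∈ S, ({p.1, p.2.1, p.2.2} : Finset α) = e) ∧ (e ∈ E → S.card = k) := by
    intro e
    by_cases he : e ∈ E
    · obtain ⟨S, hS, hcard⟩ :=
        Finset.exists_subset_card_eq (hk.trans (six_le_card_orderings (hE e he)))
      exact ⟨S, fun p hp => (Finset.mem_filter.1 (hS hp)).2, fun _ => hcard⟩
    · exact ⟨∅, by simp, fun h => absurd h he⟩
  choose S hS hcard using hsub
  refine ⟨E.biUnion S, fun x => ?_⟩
  rw [Finset.sum_biUnion, Finset.mul_sum]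
  · refine Finset.sum_congr rfl fun e he => ?_
    rw [Finset.sum_congr rfl fun p hp => mul_eq_prod_of_ordering (hE e he) (hS e p hp) x,
      Finset.sum_const, hcard e he, nsmul_eq_mul]
  · intro e _ f _ hef
    exact Finset.disjoint_left.2 fun p hp hq => hef ((hS e p hp).symm.trans (hS f p hq))

/-- For every finite `3`-graph `G` and every `k ∈ {1,…,6}` there is a finite
palette `P` with `Λ(P) = (k/6)·λ(G)`; that is, `(k/6)·Λ^{(3)} ⊆ Λ^{(3)}_pal`. -/
theorem graph_lagrangians_are_palette_lagrangians
    (n : ℕ) (E : Finset (Finset (Fin n))) (hE : ∀ e ∈ E, e.card = 3)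
    (k : ℕ) (hk : 1 ≤ k) (hk6 : k ≤ 6) :
    ∃ (c : ℕ) (T : Finset (Fin c × Fin c × Fin c)),
      paletteLagrangian c T = ((k : ℝ) / 6) * lag3graph n E := by
  obtain ⟨T, hT⟩ := exists_palette_sum_eq E hE hk6
  refine ⟨n, T, ?_⟩
  rw [paletteLagrangian, lag3graph, ← smul_eq_mul, ← Real.sSup_smul_of_nonneg (by positivity)]
  congr 1
  ext t
  simp only [Set.mem_smul_set, Set.mem_ofPred_eq, smul_eq_mul]
  constructor
  · rintro ⟨x, hx, hsum, rfl⟩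
    exact ⟨_, ⟨x, hx, hsum, rfl⟩, by rw [hT]; ring⟩
  · rintro ⟨_, ⟨x, hx, hsum, rfl⟩, rfl⟩
    exact ⟨x, hx, hsum, by rw [hT]; ring⟩
end
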